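/- Let 1 ≤ p < ∞, let ρ ⊆ [0,1) have 1 as a limit point, and let K ⊆ 𝕋 be compact such that either m(K) > 0 and K contains no compact subset of positive arc length measure satisfying Carleson's condition, or m(K) = 0. Then the set 𝒱_{A^p}^K(𝔻,ρ) is a dense G_δ subset of the Banach space A^p(𝔻). -/

import Mathlib

open Complex Metric Set Filter MeasureTheory Polynomial Topology

noncomputable section

/-- The Hardy `p`-norm of a function `f` on the unit disk:
`sup_{0<r<1} ((1/2π) ∫_0^{2π} |f(r e^{iθ})|^p dθ)^{1/p}`. -/
def hardyNorm (p : ℝ) (f : ℂ → ℂ) : ℝ :=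
  ⨆ r : Set.Ioo (0:ℝ) 1,
    ((1 / (2 * Real.pi)) *
      ∫ θ in (0:ℝ)..(2 * Real.pi),
        ‖f (((r : ℝ) : ℂ) * Complex.exp ((θ : ℂ) * Complex.I))‖ ^ p) ^ (1 / p)

/-- Membership in the Hardy space `H^p(𝔻)`: `f` is holomorphic on the unit disk and the
means `((1/2π) ∫_0^{2π} |f(r e^{iθ})|^p dθ)^{1/p}` are uniformly bounded for `0 < r < 1`. -/
def MemHp (p : ℝ) (f : ℂ → ℂ) : Prop :=
  DifferentiableOn ℂ f (Metric.ball (0:ℂ) 1) ∧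
  BddAbove (Set.range fun r : Set.Ioo (0:ℝ) 1 =>
    ((1 / (2 * Real.pi)) *
      ∫ θ in (0:ℝ)..(2 * Real.pi),
        ‖f (((r : ℝ) : ℂ) * Complex.exp ((θ : ℂ) * Complex.I))‖ ^ p) ^ (1 / p))

/-- The Hardy space `H^p(𝔻)` as a type. -/
def HpSpace (p : ℝ) := {f : ℂ → ℂ // MemHp p f}

/-- The norm topology on `H^p(𝔻)`, generated by the open balls of the Hardy norm. -/
instance hpTopology (p : ℝ) : TopologicalSpace (HpSpace p) :=
  TopologicalSpace.generateFrom
    {U : Set (HpSpace p) | ∃ (f : HpSpace p) (ε : ℝ), 0 < ε ∧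
      U = {g : HpSpace p | hardyNorm p (fun z => g.1 z - f.1 z) < ε}}

/-- The arc length measure of a subset `K` of the unit circle `𝕋 ⊆ ℂ`, computed as the
Lebesgue measure of the set of angles `θ ∈ [0, 2π)` with `e^{iθ} ∈ K`. -/
def arcMeasure (K : Set ℂ) : ENNReal :=
  MeasureTheory.volume {θ : ℝ | θ ∈ Set.Ico (0:ℝ) (2 * Real.pi) ∧
    Complex.exp ((θ : ℂ) * Complex.I) ∈ K}

/-- The Bergman `p`-norm of `f` on the unit disk, with respect to normalised area measure. -/
def bergmanNorm (p : ℝ) (f : ℂ → ℂ) : ℝ :=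
  ((Real.pi)⁻¹ * ∫ z in Metric.ball (0:ℂ) 1, ‖f z‖ ^ p) ^ (1 / p)

/-- Membership in the Bergman space `A^p(𝔻)`: `f` is holomorphic on the unit disk and
`|f|^p` is integrable there. -/
def MemAp (p : ℝ) (f : ℂ → ℂ) : Prop :=
  DifferentiableOn ℂ f (Metric.ball (0:ℂ) 1) ∧
  MeasureTheory.IntegrableOn (fun z => ‖f z‖ ^ p) (Metric.ball (0:ℂ) 1)

/-- The Bergman space `A^p(𝔻)` as a type. -/
def ApSpace (p : ℝ) := {f : ℂ → ℂ // MemAp p f}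

/-- The norm topology on `A^p(𝔻)`, generated by the open balls of the Bergman norm. -/
instance apTopology (p : ℝ) : TopologicalSpace (ApSpace p) :=
  TopologicalSpace.generateFrom
    {U : Set (ApSpace p) | ∃ (f : ApSpace p) (ε : ℝ), 0 < ε ∧
      U = {g : ApSpace p | bergmanNorm p (fun z => g.1 z - f.1 z) < ε}}

/-- A subset of the unit circle is an open subarc if it is the image under `θ ↦ e^{iθ}` of a
nonempty open interval of length at most `2π`. -/
def IsOpenArc (B : Set ℂ) : Prop :=
  ∃ a b : ℝ, a < b ∧ b ≤ a + 2 * Real.pi ∧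
    B = (fun θ : ℝ => Complex.exp ((θ : ℂ) * Complex.I)) '' Set.Ioo a b

/-- A compact subset `E` of the unit circle (of positive arc length) satisfies Carleson's
condition if, writing `𝕋 \ E` as a disjoint union of open subarcs `B k`, one has
`Σ_k m(B_k) log(1/m(B_k)) < ∞`. -/
def SatisfiesCarleson (E : Set ℂ) : Prop :=
  ∃ B : ℕ → Set ℂ, (∀ k, IsOpenArc (B k) ∨ B k = ∅) ∧
    Pairwise (Function.onFun Disjoint B) ∧
    Metric.sphere (0:ℂ) 1 \ E = ⋃ k, B k ∧
    Summable (fun k =>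
      (arcMeasure (B k)).toReal * Real.log (1 / (arcMeasure (B k)).toReal))

/-- The admissibility condition on `K ⊆ 𝕋` for the Bergman space results: either `m(K) > 0`
and `K` contains no compact subset of positive arc length satisfying Carleson's condition, or
`m(K) = 0`. -/
def BergmanAdmissible (K : Set ℂ) : Prop :=
  (arcMeasure K ≠ 0 ∧
    ∀ E : Set ℂ, E ⊆ K → IsCompact E → arcMeasure E ≠ 0 → ¬ SatisfiesCarleson E) ∨
  arcMeasure K = 0

/-- The class `𝒱_{A^p}^K(𝔻,ρ)` of functions in `A^p(𝔻)` with universal radial limits on `K`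
along dilation parameters from `ρ`. -/
def VAp (p : ℝ) (ρ : Set ℝ) (K : Set ℂ) : Set (ApSpace p) :=
  {f : ApSpace p | ∀ φ : ℂ → ℂ, ContinuousOn φ K →
    ∀ L : Set ℂ, IsCompact L → L ⊆ Metric.ball (0:ℂ) 1 →
      ∃ r : ℕ → ℝ, (∀ n, r n ∈ ρ) ∧ StrictMono r ∧
        Filter.Tendsto r Filter.atTop (nhds 1) ∧
        Filter.Tendsto
          (fun n => ⨆ ζ ∈ K, ⨆ z ∈ L, ‖f.1 (((r n : ℝ) : ℂ) * (ζ - z) + z) - φ ζ‖)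
          Filter.atTop (nhds 0)}

/-- Lebesgue area measure on the unit disk. -/
def diskMeasure : Measure ℂ := volume.restrict (ball (0:ℂ) 1)

instance : IsFiniteMeasure diskMeasure :=
  ⟨by simp [diskMeasure]⟩

theorem memAp_iff_memLp {p : ℝ} (hp : 1 ≤ p) {f : ℂ → ℂ} :
    MemAp p f ↔ DifferentiableOn ℂ f (ball 0 1) ∧ MemLp f (ENNReal.ofReal p) diskMeasure := by
  refine and_congr_right fun hf => ?_
  have hm : AEStronglyMeasurable f diskMeasure :=
    hf.continuousOn.aestronglyMeasurable measurableSet_ball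
  have h0 : ENNReal.ofReal p ≠ 0 := by simp; linarith
  have := integrable_norm_rpow_iff hm h0 ENNReal.ofReal_ne_top
  rw [ENNReal.toReal_ofReal (by linarith)] at this
  exact this

theorem DiffContOnCl.setIntegral_closedBall {f : ℂ → ℂ} {z : ℂ} {δ : ℝ}
    (hf : DiffContOnCl ℂ f (ball z δ)) :
    ∫ w in closedBall (0:ℂ) δ, f (z + w) = ((volume (closedBall (0:ℂ) δ)).toReal : ℂ) * f z := by
  have hcont : ContinuousOn f (closedBall z δ) := hf.continuousOn_ball
  have hrot : ∀ θ : ℝ, ∫ w in closedBall (0:ℂ) δ, f (z + exp (θ * I) * w)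
      = ∫ w in closedBall (0:ℂ) δ, f (z + w) := by
    intro θ
    have hmp := (rotation (Circle.exp θ)).measurePreserving
    have := hmp.setIntegral_preimage_emb
      (rotation (Circle.exp θ)).toHomeomorph.measurableEmbedding (fun w => f (z + w))
      (closedBall (0:ℂ) δ)
    rw [← this]
    have h1 : (rotation (Circle.exp θ)) ⁻¹' closedBall (0:ℂ) δ = closedBall (0:ℂ) δ := by
      ext w
      rw [mem_preimage, mem_closedBall_zero_iff, LinearIsometryEquiv.norm_map,
        mem_closedBall_zero_iff]
    rw [h1]
    simp
  have hcirc : ∀ w ∈ closedBall (0:ℂ) δ,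
      ∫ θ in (0:ℝ)..(2 * Real.pi), f (z + exp (θ * I) * w) = ((2 * Real.pi : ℝ) : ℂ) * f z := by
    intro w hw
    have hw' : ‖w‖ ≤ δ := by simpa using hw
    have h1 : DiffContOnCl ℂ f (ball z |‖w‖|) := by
      rw [abs_norm]; exact hf.mono (ball_subset_ball hw')
    have h2 := h1.circleAverage
    rw [Real.circleAverage_def] at h2
    have hpi : (2 * Real.pi : ℝ) ≠ 0 := by positivity
    have h3 : ∫ θ in (0:ℝ)..(2 * Real.pi), f (circleMap z ‖w‖ θ)
        = ((2 * Real.pi : ℝ) : ℂ) * f z := by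
      rw [← h2]; simp [← mul_assoc]
    rw [← h3]
    have h4 : ∀ θ : ℝ, z + exp (θ * I) * w = circleMap z ‖w‖ (θ + arg w) := by
      intro θ
      rw [circleMap]
      conv_lhs => rw [← norm_mul_exp_arg_mul_I w]
      push_cast
      rw [add_mul, exp_add]; ring
    simp_rw [h4]
    rw [intervalIntegral.integral_comp_add_right (fun θ => f (circleMap z ‖w‖ θ)),
      zero_add, add_comm (2 * Real.pi) (arg w)]
    have hper : Function.Periodic (fun θ => f (circleMap z ‖w‖ θ)) (2 * Real.pi) := fun θ => by
      simp only [periodic_circleMap z ‖w‖ θ]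
    have := hper.intervalIntegral_add_eq (arg w) 0
    rwa [zero_add] at this
  have h_int : IntegrableOn (Function.uncurry fun (θ : ℝ) (w : ℂ) => f (z + exp (θ * I) * w))
      (Icc (0:ℝ) (2 * Real.pi) ×ˢ closedBall (0:ℂ) δ) (volume.prod volume) := by
    apply ContinuousOn.integrableOn_compact (isCompact_Icc.prod (isCompact_closedBall _ _))
    apply hcont.comp (by fun_prop)
    rintro ⟨θ, w⟩ ⟨-, hw⟩
    simpa [norm_exp_ofReal_mul_I] using hw
  have hswap : ∫ θ in (0:ℝ)..(2 * Real.pi), ∫ w in closedBall (0:ℂ) δ, f (z + exp (θ * I) * w)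
      = ∫ w in closedBall (0:ℂ) δ, ∫ θ in (0:ℝ)..(2 * Real.pi), f (z + exp (θ * I) * w) := by
    simp_rw [intervalIntegral.integral_of_le Real.two_pi_pos.le]
    apply integral_integral_swap
    rw [Measure.prod_restrict]
    exact h_int.mono_set (prod_mono Ioc_subset_Icc_self subset_rfl)
  simp_rw [hrot] at hswap
  rw [setIntegral_congr_fun measurableSet_closedBall hcirc] at hswap
  simp only [intervalIntegral.integral_const, sub_zero, integral_const,
    measureReal_restrict_apply_univ, Complex.real_smul] at hswap
  have hpi : ((2 * Real.pi : ℝ) : ℂ) ≠ 0 := by exact_mod_cast Real.two_pi_pos.ne'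
  apply mul_left_cancel₀ hpi
  rw [hswap, Measure.real]
  push_cast; ring

section BergmanSpace

variable {p : ℝ}

instance [Fact (1 ≤ p)] : Fact (1 ≤ ENNReal.ofReal p) :=
  ⟨by simpa using ENNReal.ofReal_le_ofReal (Fact.out : 1 ≤ p)⟩

theorem ApSpace.memLp [hp : Fact (1 ≤ p)] (f : ApSpace p) :
    MemLp f.1 (ENNReal.ofReal p) diskMeasure := ((memAp_iff_memLp hp.out).1 f.2).2

/-- The embedding of the Bergman space into the Lebesgue space of the disk. -/
def ApSpace.toLp [Fact (1 ≤ p)] (f : ApSpace p) : Lp ℂ (ENNReal.ofReal p) diskMeasure :=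
  f.memLp.toLp f.1

theorem exists_norm_le_eLpNorm [hp : Fact (1 ≤ p)] {r : ℝ} (hr : r < 1) :
    ∃ C : ℝ, 0 < C ∧ ∀ f : ℂ → ℂ, MemAp p f → ∀ z ∈ closedBall (0:ℂ) r,
      ‖f z‖ ≤ C * (eLpNorm f (ENNReal.ofReal p) diskMeasure).toReal := by
  set δ := (1 - r) / 2 with hδ
  have hδ0 : 0 < δ := by rw [hδ]; linarith
  set V := (volume (closedBall (0:ℂ) δ)).toReal with hV
  have hV0 : 0 < V := ENNReal.toReal_pos (measure_closedBall_pos _ _ hδ0).ne'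
    (measure_closedBall_lt_top).ne
  set D := (diskMeasure univ ^ (1 / (1:ENNReal).toReal - 1 / (ENNReal.ofReal p).toReal)).toReal
  refine ⟨V⁻¹ * (D + 1), by positivity, fun f hf z hz => ?_⟩
  have hfL := (memAp_iff_memLp hp.out).1 hf
  have hsub : closedBall z δ ⊆ ball 0 1 := by
    intro w hw
    have h1 : ‖z‖ ≤ r := by simpa using hz
    have h2 : ‖w - z‖ ≤ δ := by simpa [dist_eq_norm] using hw
    have h3 : ‖w‖ ≤ ‖w - z‖ + ‖z‖ := by simpa using norm_add_le (w - z) z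
    simp only [mem_ball_zero_iff]; linarith
  have hd : DiffContOnCl ℂ f (ball z δ) := hfL.1.diffContOnCl_ball hsub
  have h1 := hd.setIntegral_closedBall
  have h_int : Integrable f diskMeasure :=
    hfL.2.integrable (Fact.out)
  have h2 : ‖∫ w in closedBall (0:ℂ) δ, f (z + w)‖ ≤ ∫ w, ‖f w‖ ∂diskMeasure := by
    have hmp : MeasurePreserving (fun w : ℂ => z + w) := measurePreserving_add_left volume z
    have := hmp.setIntegral_preimage_emb (Homeomorph.addLeft z).measurableEmbedding
      f (closedBall z δ)
    have hpre : (fun w : ℂ => z + w) ⁻¹' closedBall z δ = closedBall (0:ℂ) δ := by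
      ext w; simp [dist_eq_norm]
    rw [hpre] at this
    rw [this]
    refine (norm_integral_le_integral_norm _).trans ?_
    exact setIntegral_mono_set (h_int.norm) (ae_of_all _ fun _ => norm_nonneg _)
      (LE.le.eventuallyLE hsub)
  have h3 : ∫ w, ‖f w‖ ∂diskMeasure ≤ (eLpNorm f (ENNReal.ofReal p) diskMeasure).toReal * D := by
    have h4 := eLpNorm_le_eLpNorm_mul_rpow_measure_univ (Fact.out : 1 ≤ ENNReal.ofReal p)
      hfL.2.1
    have h5 : (eLpNorm f 1 diskMeasure).toReal = ∫ w, ‖f w‖ ∂diskMeasure := by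
      rw [eLpNorm_one_eq_lintegral_enorm, integral_norm_eq_lintegral_enorm hfL.2.1]
    rw [← h5, ← ENNReal.toReal_mul]
    apply ENNReal.toReal_mono _ h4
    apply ENNReal.mul_ne_top hfL.2.2.ne
    apply ENNReal.rpow_ne_top_of_nonneg _ (measure_ne_top _ _)
    have : (1:ℝ) ≤ p := hp.out
    rw [ENNReal.toReal_ofReal (by linarith)]
    simp only [ENNReal.toReal_one, div_one, one_div, sub_nonneg]
    exact inv_le_one_of_one_le₀ this
  have h6 : V * ‖f z‖ ≤ (eLpNorm f (ENNReal.ofReal p) diskMeasure).toReal * D := by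
    have : ‖(V:ℂ) * f z‖ = V * ‖f z‖ := by
      rw [norm_mul, norm_real, Real.norm_of_nonneg hV0.le]
    rw [← this, ← h1]
    exact h2.trans h3
  rw [mul_assoc, ← div_eq_inv_mul, le_div_iff₀ hV0]
  have : 0 ≤ (eLpNorm f (ENNReal.ofReal p) diskMeasure).toReal := ENNReal.toReal_nonneg
  nlinarith

theorem ApSpace.norm_toLp_sub [hp : Fact (1 ≤ p)] (f g : ApSpace p) :
    ‖f.toLp - g.toLp‖ = (eLpNorm (f.1 - g.1) (ENNReal.ofReal p) diskMeasure).toReal := by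
  rw [ApSpace.toLp, ApSpace.toLp, ← MemLp.toLp_sub, Lp.norm_toLp]

theorem bergmanNorm_eq [hp : Fact (1 ≤ p)] {f : ℂ → ℂ}
    (hf : MemLp f (ENNReal.ofReal p) diskMeasure) :
    bergmanNorm p f = (Real.pi⁻¹) ^ (1 / p) *
      (eLpNorm f (ENNReal.ofReal p) diskMeasure).toReal := by
  have hp1 : (1:ℝ) ≤ p := hp.out
  have h0 : ENNReal.ofReal p ≠ 0 := by simp; linarith
  rw [hf.eLpNorm_eq_integral_rpow_norm h0 ENNReal.ofReal_ne_top,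
    ENNReal.toReal_ofReal (by positivity), ENNReal.toReal_ofReal (by linarith), bergmanNorm,
    Real.mul_rpow (by positivity) (by positivity), one_div]
  rfl

theorem MemAp.sub (hp : 1 ≤ p) {f g : ℂ → ℂ} (hf : MemAp p f) (hg : MemAp p g) :
    MemAp p (f - g) := by
  rw [memAp_iff_memLp hp] at *
  exact ⟨hf.1.sub hg.1, hf.2.sub hg.2⟩

theorem apTopology_eq_induced [hp : Fact (1 ≤ p)] :
    apTopology p = TopologicalSpace.induced ApSpace.toLp inferInstance := by
  symm
  let P : PseudoMetricSpace (ApSpace p) := PseudoMetricSpace.induced ApSpace.toLp inferInstance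
  have hκ : 0 < (Real.pi⁻¹) ^ (1 / p) := by positivity
  have hball : ∀ (f : ApSpace p) (ε : ℝ),
      {g : ApSpace p | bergmanNorm p (fun z => g.1 z - f.1 z) < ε}
        = Metric.ball f (ε / (Real.pi⁻¹) ^ (1 / p)) := by
    intro f ε
    ext g
    have h1 : dist g f = ‖g.toLp - f.toLp‖ := by
      rw [← dist_eq_norm]; rfl
    rw [Metric.mem_ball, h1, ApSpace.norm_toLp_sub, Set.mem_ofPred_eq, lt_div_iff₀ hκ]
    have := bergmanNorm_eq (g.memLp.sub f.memLp)
    rw [mul_comm, ← this]; rfl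
  have hb : @TopologicalSpace.IsTopologicalBasis (ApSpace p) P.toUniformSpace.toTopologicalSpace
      {U : Set (ApSpace p) | ∃ (f : ApSpace p) (ε : ℝ), 0 < ε ∧
      U = {g : ApSpace p | bergmanNorm p (fun z => g.1 z - f.1 z) < ε}} := by
    apply @TopologicalSpace.isTopologicalBasis_of_isOpen_of_nhds _
      P.toUniformSpace.toTopologicalSpace
    · rintro U ⟨f, ε, hε, rfl⟩
      rw [hball]; exact @Metric.isOpen_ball _ P _ _
    · intro f U hf hU
      obtain ⟨ε, hε, h⟩ := (@Metric.isOpen_iff _ P _).1 hU f hf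
      refine ⟨_, ⟨f, ε * (Real.pi⁻¹) ^ (1 / p), by positivity, rfl⟩, ?_, ?_⟩
      · rw [hball, mul_div_cancel_right₀ _ hκ.ne']; exact Metric.mem_ball_self hε
      · rw [hball, mul_div_cancel_right₀ _ hκ.ne']; exact h
  exact @TopologicalSpace.IsTopologicalBasis.eq_generateFrom _
    P.toUniformSpace.toTopologicalSpace _ hb

/-- The pseudometric of the Bergman space, inducing its norm topology. -/
abbrev apPseudoMetric [hp : Fact (1 ≤ p)] : PseudoMetricSpace (ApSpace p) :=
  (PseudoMetricSpace.induced ApSpace.toLp inferInstance).replaceTopology apTopology_eq_induced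

theorem isClosed_range_toLp [hp : Fact (1 ≤ p)] :
    IsClosed (range (ApSpace.toLp (p := p))) := by
  apply IsSeqClosed.isClosed
  intro u g hu hg
  choose f hf using hu
  have hcau : ∀ r < 1, UniformCauchySeqOn (fun n => (f n).1) atTop (closedBall (0:ℂ) r) := by
    intro r hr
    obtain ⟨C, hC, hle⟩ := exists_norm_le_eLpNorm (p := p) hr
    rw [Metric.uniformCauchySeqOn_iff]
    intro ε hε
    obtain ⟨N, hN⟩ := Metric.cauchySeq_iff.1 hg.cauchySeq (ε / C) (by positivity)
    refine ⟨N, fun m hm n hn z hz => ?_⟩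
    have h1 := hle _ (MemAp.sub hp.out (f m).2 (f n).2) z hz
    rw [← ApSpace.norm_toLp_sub, hf, hf, ← dist_eq_norm] at h1
    have h2 := hN m hm n hn
    rw [lt_div_iff₀ hC] at h2
    rw [dist_eq_norm]
    exact h1.trans_lt (by linarith)
  have hlim : ∀ z ∈ ball (0:ℂ) 1, ∃ w, Tendsto (fun n => (f n).1 z) atTop (𝓝 w) := by
    intro z hz
    have hz' : ‖z‖ < 1 := by simpa using hz
    exact cauchySeq_tendsto_of_complete ((hcau ‖z‖ hz').cauchySeq (by simp))
  choose! F hF using hlim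
  have hloc : TendstoLocallyUniformlyOn (fun n => (f n).1) F atTop (ball 0 1) := by
    rw [tendstoLocallyUniformlyOn_iff_forall_isCompact isOpen_ball]
    intro S hS hSc
    obtain ⟨r, hr, hSr⟩ : ∃ r < 1, S ⊆ closedBall (0:ℂ) r := by
      rcases S.eq_empty_or_nonempty with rfl | hne
      · exact ⟨0, by norm_num, by simp⟩
      obtain ⟨x, hx, hmax⟩ := hSc.exists_isMaxOn hne continuous_norm.continuousOn
      exact ⟨‖x‖, by simpa using hS hx, fun y hy => by simpa using hmax hy⟩
    exact ((hcau r hr).mono hSr).tendstoUniformlyOn_of_tendsto fun z hz => hF z (hS hz)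
  have hFd : DifferentiableOn ℂ F (ball 0 1) :=
    hloc.differentiableOn (Eventually.of_forall fun n => (f n).2.1) isOpen_ball
  obtain ⟨ns, hns, hae⟩ := (tendstoInMeasure_of_tendsto_Lp hg).exists_seq_tendsto_ae
  have hcoe : ∀ᵐ z ∂diskMeasure, ∀ n, (u n : ℂ → ℂ) z = (f n).1 z := by
    rw [ae_all_iff]; intro n
    rw [← hf n]; exact (f n).memLp.coeFn_toLp
  have hFg : F =ᵐ[diskMeasure] g := by
    have hmem : ∀ᵐ z ∂diskMeasure, z ∈ ball (0:ℂ) 1 := ae_restrict_mem measurableSet_ball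
    filter_upwards [hae, hcoe, hmem] with z h1 h2 h3
    simp_rw [h2] at h1
    exact tendsto_nhds_unique ((hF z h3).comp hns.tendsto_atTop) h1
  have hFL : MemLp F (ENNReal.ofReal p) diskMeasure := (memLp_congr_ae hFg).2 (Lp.memLp g)
  refine ⟨⟨F, (memAp_iff_memLp hp.out).2 ⟨hFd, hFL⟩⟩, ?_⟩
  apply Lp.ext
  exact (MemLp.coeFn_toLp _).trans hFg

theorem ApSpace.baireSpace [hp : Fact (1 ≤ p)] : BaireSpace (ApSpace p) := by
  let _ := apPseudoMetric (p := p)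
  have hu : IsUniformInducing (ApSpace.toLp (p := p)) := ⟨rfl⟩
  have : CompleteSpace (ApSpace p) := by
    rw [completeSpace_iff_isComplete_range hu]
    exact isClosed_range_toLp.isComplete
  infer_instance

end BergmanSpace

theorem norm_dilate_le {r s : ℝ} (hr0 : 0 ≤ r) (hr1 : r ≤ 1) {ζ z : ℂ} (hζ : ‖ζ‖ = 1)
    (hz : ‖z‖ ≤ s) : ‖(r : ℂ) * (ζ - z) + z‖ ≤ r + (1 - r) * s := by
  have h : (r : ℂ) * (ζ - z) + z = r * ζ + ((1 - r : ℝ) : ℂ) * z := by push_cast; ring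
  rw [h]
  refine (norm_add_le _ _).trans ?_
  rw [norm_mul, norm_mul, norm_real, norm_real, hζ, Real.norm_of_nonneg hr0,
    Real.norm_of_nonneg (by linarith), mul_one]
  gcongr

theorem exists_subset_closedBall_of_isCompact {L : Set ℂ} (hL : IsCompact L)
    (hLb : L ⊆ ball (0:ℂ) 1) : ∃ m : ℕ, L ⊆ closedBall (0:ℂ) (1 - 1 / ((m : ℝ) + 1)) := by
  obtain ⟨r, hr, hSr⟩ : ∃ r < 1, L ⊆ closedBall (0:ℂ) r := by
    rcases L.eq_empty_or_nonempty with rfl | hne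
    · exact ⟨0, by norm_num, by simp⟩
    obtain ⟨x, hx, hmax⟩ := hL.exists_isMaxOn hne continuous_norm.continuousOn
    exact ⟨‖x‖, by simpa using hLb hx, fun y hy => by simpa using hmax hy⟩
  obtain ⟨m, hm⟩ := exists_nat_one_div_lt (sub_pos.2 hr)
  exact ⟨m, hSr.trans (closedBall_subset_closedBall (by linarith))⟩

theorem le_iSup_dilate {K L : Set ℂ} (hKc : IsCompact K) (hKT : K ⊆ sphere (0:ℂ) 1)
    (hL : IsCompact L) (hLb : L ⊆ ball (0:ℂ) 1) {f φ : ℂ → ℂ}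
    (hf : ContinuousOn f (ball 0 1)) (hφ : ContinuousOn φ K) {r : ℝ} (hr : r ∈ Ico (0:ℝ) 1)
    {ζ z : ℂ} (hζ : ζ ∈ K) (hz : z ∈ L) :
    ‖f ((r : ℂ) * (ζ - z) + z) - φ ζ‖
      ≤ ⨆ ζ ∈ K, ⨆ z ∈ L, ‖f ((r : ℂ) * (ζ - z) + z) - φ ζ‖ := by
  have hcont : ContinuousOn (fun q : ℂ × ℂ => ‖f ((r : ℂ) * (q.1 - q.2) + q.2) - φ q.1‖)
      (K ×ˢ L) := by
    refine ((hf.comp (by fun_prop) ?_).sub (hφ.comp (by fun_prop) ?_)).norm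
    · rintro ⟨ζ, z⟩ ⟨h1, h2⟩
      have h2' : ‖z‖ < 1 := by simpa using hLb h2
      have := norm_dilate_le hr.1 hr.2.le (by simpa using hKT h1) (le_refl ‖z‖)
      simp only [mem_ball_zero_iff]
      have h3 : 0 < 1 - r := by linarith [hr.2]
      nlinarith
    · rintro ⟨ζ, z⟩ ⟨h1, h2⟩; exact h1
  obtain ⟨B, hB⟩ := ((hKc.prod hL).image_of_continuousOn hcont).bddAbove
  have hB' : ∀ ζ ∈ K, ∀ z ∈ L, ‖f ((r : ℂ) * (ζ - z) + z) - φ ζ‖ ≤ max B 0 := fun ζ h1 z h2 =>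
    (hB (mem_image_of_mem _ (mk_mem_prod h1 h2) :)).trans (le_max_left _ _)
  have h0 : 0 ≤ max B 0 := le_max_right _ _
  have hin : ∀ ζ ∈ K, ⨆ z ∈ L, ‖f ((r : ℂ) * (ζ - z) + z) - φ ζ‖ ≤ max B 0 := fun ζ h1 =>
    Real.iSup_le (fun z => Real.iSup_le (fun h2 => hB' ζ h1 z h2) h0) h0
  have e1 : ‖f ((r : ℂ) * (ζ - z) + z) - φ ζ‖ ≤ ⨆ z ∈ L, ‖f ((r : ℂ) * (ζ - z) + z) - φ ζ‖ := by
    have : BddAbove (range fun z => ⨆ (_ : z ∈ L), ‖f ((r : ℂ) * (ζ - z) + z) - φ ζ‖) := by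
      refine ⟨max B 0, ?_⟩
      rintro _ ⟨z, rfl⟩
      exact Real.iSup_le (fun h2 => hB' ζ hζ z h2) h0
    refine le_trans ?_ (le_ciSup this z)
    simp [hz]
  have e2 : BddAbove (range fun ζ => ⨆ (_ : ζ ∈ K), ⨆ z ∈ L,
      ‖f ((r : ℂ) * (ζ - z) + z) - φ ζ‖) := by
    refine ⟨max B 0, ?_⟩
    rintro _ ⟨ζ, rfl⟩
    exact Real.iSup_le (fun h2 => hin ζ h2) h0
  refine le_trans ?_ (le_ciSup e2 ζ)
  simpa [hζ] using e1

section UniversalSet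

variable {p : ℝ}

/-- Functions some dilation of which, with parameter in `ρ` close to `1`, is close to `ψ` on `K`. -/
def nearDilateSet (p : ℝ) (ρ : Set ℝ) {K : Set ℂ} (ψ : K → ℂ) (m N : ℕ) : Set (ApSpace p) :=
  {f | ∃ r ∈ ρ, 1 - 1 / ((N : ℝ) + 1) < r ∧ ∃ η < 1 / ((N : ℝ) + 1), ∀ ζ : K,
    ∀ z ∈ closedBall (0:ℂ) (1 - 1 / ((m : ℝ) + 1)), ‖f.1 ((r : ℂ) * (ζ - z) + z) - ψ ζ‖ ≤ η}

theorem isOpen_nearDilateSet [hp : Fact (1 ≤ p)] {ρ : Set ℝ} (hρ : ρ ⊆ Ico (0:ℝ) 1) {K : Set ℂ}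
    (hKT : K ⊆ sphere (0:ℂ) 1) (ψ : K → ℂ) (m N : ℕ) : IsOpen (nearDilateSet p ρ ψ m N) := by
  let _ := apPseudoMetric (p := p)
  rw [Metric.isOpen_iff]
  rintro f ⟨r, hr, hrN, η, hη, h⟩
  have hr1 := (hρ hr).2
  have hr0 := (hρ hr).1
  set s : ℝ := 1 - 1 / ((m : ℝ) + 1)
  have hs : s < 1 := by
    have : 0 < 1 / ((m : ℝ) + 1) := by positivity
    simp only [s]; linarith
  have hR : r + (1 - r) * s < 1 := by nlinarith
  obtain ⟨C, hC, hle⟩ := exists_norm_le_eLpNorm (p := p) hR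
  set d := 1 / ((N : ℝ) + 1) - η with hd
  have hd0 : 0 < d := by rw [hd]; linarith
  refine ⟨d / (2 * C), by positivity, fun g hg => ?_⟩
  refine ⟨r, hr, hrN, η + d / 2, by rw [hd]; linarith, fun ζ z hz => ?_⟩
  set w := (r : ℂ) * (ζ - z) + z
  have hw : ‖w‖ ≤ r + (1 - r) * s :=
    norm_dilate_le hr0 hr1.le (by simpa using hKT ζ.2) (mem_closedBall_zero_iff.1 hz)
  have h1 := hle _ (MemAp.sub hp.out g.2 f.2) w (by simpa using hw)
  rw [← ApSpace.norm_toLp_sub] at h1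
  have h2 : ‖g.toLp - f.toLp‖ < d / (2 * C) := by
    rw [← dist_eq_norm]; exact hg
  have h3 : C * ‖g.toLp - f.toLp‖ ≤ d / 2 := by
    have := mul_le_mul_of_nonneg_left h2.le hC.le
    refine this.trans (le_of_eq ?_)
    field_simp
  have h4 := h ζ z hz
  calc ‖g.1 w - ψ ζ‖ = ‖(f.1 w - ψ ζ) + (g.1 - f.1) w‖ := by
        congr 1; simp only [Pi.sub_apply]; ring
    _ ≤ η + d / 2 := (norm_add_le _ _).trans (add_le_add h4 (h1.trans h3))

theorem exists_gt_of_accPt_one {ρ : Set ℝ} (hρ1 : AccPt (1:ℝ) (𝓟 ρ)) {a : ℝ} (ha : a < 1) :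
    ∃ r ∈ ρ, a < r := by
  rw [accPt_iff_nhds] at hρ1
  obtain ⟨y, ⟨hy1, hy2⟩, -⟩ := hρ1 (Ioi a) (Ioi_mem_nhds ha)
  exact ⟨y, hy2, hy1⟩

theorem dense_nearDilateSet [hp : Fact (1 ≤ p)] {ρ : Set ℝ} (hρ : ρ ⊆ Ico (0:ℝ) 1)
    (hρ1 : AccPt (1:ℝ) (𝓟 ρ)) {K : Set ℂ} (hKT : K ⊆ sphere (0:ℂ) 1) (ψ : K → ℂ)
    (happrox : ∀ (f : ApSpace p) (ε : ℝ), 0 < ε → ∃ g : ApSpace p,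
      ContinuousOn g.1 (closedBall 0 1) ∧ ‖g.toLp - f.toLp‖ < ε ∧ ∀ ζ : K, ‖g.1 ζ - ψ ζ‖ < ε)
    (m N : ℕ) : Dense (nearDilateSet p ρ ψ m N) := by
  let _ := apPseudoMetric (p := p)
  rw [Metric.dense_iff]
  intro f ε hε
  set d := 1 / ((N : ℝ) + 1) with hd
  have hd0 : 0 < d := by positivity
  obtain ⟨g, hgc, hgf, hgK⟩ := happrox f (min ε (d / 4)) (by positivity)
  refine ⟨g, ?_, ?_⟩
  · have : dist g f = ‖g.toLp - f.toLp‖ := by rw [← dist_eq_norm]; rfl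
    rw [Metric.mem_ball, this]
    exact hgf.trans_le (min_le_left _ _)
  · have huc := (isCompact_closedBall (0:ℂ) 1).uniformContinuousOn_of_continuous hgc
    rw [Metric.uniformContinuousOn_iff] at huc
    obtain ⟨δ, hδ, hu⟩ := huc (d / 4) (by positivity)
    obtain ⟨r, hr, hlt⟩ := exists_gt_of_accPt_one hρ1
      (a := max (1 - d) (1 - δ / 2)) (max_lt (by linarith) (by linarith))
    have hr1 := (hρ hr).2
    have hr0 := (hρ hr).1
    have hlt1 := (le_max_left _ _).trans_lt hlt
    have hlt2 := (le_max_right _ _).trans_lt hlt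
    refine ⟨r, hr, hlt1, d / 2, by linarith, fun ζ z hz => ?_⟩
    have hζ : ‖(ζ : ℂ)‖ = 1 := by simpa using hKT ζ.2
    have hz1 : ‖z‖ ≤ 1 := by
      have : ‖z‖ ≤ 1 - 1 / ((m : ℝ) + 1) := by simpa using hz
      have h2 : 0 < 1 / ((m : ℝ) + 1) := by positivity
      linarith
    have h1 := norm_dilate_le hr0 hr1.le hζ hz1
    have h2 : dist ((r : ℂ) * (ζ - z) + z) ζ < δ := by
      have : (r : ℂ) * (ζ - z) + z - ζ = ((1 - r : ℝ) : ℂ) * (z - ζ) := by push_cast; ring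
      rw [dist_eq_norm, this, norm_mul, norm_real, Real.norm_of_nonneg (by linarith)]
      have h3 : ‖z - ζ‖ ≤ 2 := (norm_sub_le _ _).trans (by linarith)
      nlinarith
    have h3 := hu _ (by simp; linarith) ζ (by simp [hζ]) h2
    rw [dist_eq_norm] at h3
    have h4 := (hgK ζ).trans_le (min_le_right _ _)
    calc ‖g.1 ((r : ℂ) * (ζ - z) + z) - ψ ζ‖
        = ‖(g.1 ((r : ℂ) * (ζ - z) + z) - g.1 ζ) + (g.1 ζ - ψ ζ)‖ := by congr 1; ring
      _ ≤ d / 4 + d / 4 := (norm_add_le _ _).trans (add_le_add h3.le h4.le)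
      _ = d / 2 := by ring

theorem VAp_eq_iInter {ρ : Set ℝ} (hρ : ρ ⊆ Ico (0:ℝ) 1)
    {K : Set ℂ} (hKc : IsCompact K) (hKT : K ⊆ sphere (0:ℂ) 1)
    {Φ : ℕ → C(K, ℂ)} (hΦ : DenseRange Φ) :
    VAp p ρ K = ⋂ q : ℕ × ℕ × ℕ, nearDilateSet p ρ (Φ q.1) q.2.1 q.2.2 := by
  have : CompactSpace K := isCompact_iff_compactSpace.1 hKc
  ext f
  simp only [mem_iInter, Prod.forall]
  have hfc : ContinuousOn f.1 (ball 0 1) := f.2.1.continuousOn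
  constructor
  · intro hf j m N
    obtain ⟨φ, hφ⟩ : ∃ φ : ℂ → ℂ, ∀ ζ : K, φ ζ = Φ j ζ :=
      ⟨Function.extend Subtype.val (Φ j) 0, fun ζ => Subtype.val_injective.extend_apply _ _ _⟩
    have hφc : ContinuousOn φ K := by
      rw [continuousOn_iff_continuous_domRestrict]
      convert (Φ j).continuous using 1
      ext ζ; exact hφ ζ
    have hd0 : 0 < 1 / ((N : ℝ) + 1) := by positivity
    have hLb : closedBall (0:ℂ) (1 - 1 / ((m : ℝ) + 1)) ⊆ ball 0 1 :=
      closedBall_subset_ball (by have : 0 < 1 / ((m : ℝ) + 1) := by positivity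
                                 linarith)
    obtain ⟨r, hrρ, -, hr1, hr⟩ := hf φ hφc _ (isCompact_closedBall 0 _) hLb
    have e1 := hr1.eventually (Ioi_mem_nhds (show 1 - 1 / ((N : ℝ) + 1) < 1 by linarith))
    have e2 := hr.eventually (Iio_mem_nhds (half_pos hd0))
    obtain ⟨n, h1, h2⟩ := (e1.and e2).exists
    refine ⟨r n, hrρ n, h1, _, half_lt_self hd0, fun ζ z hz => ?_⟩
    rw [← hφ]
    exact (le_iSup_dilate hKc hKT (isCompact_closedBall 0 _) hLb hfc hφc (hρ (hrρ n))
      ζ.2 hz).trans (le_of_lt h2)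
  · intro hf φ hφ L hL hLb
    obtain ⟨m, hm⟩ := exists_subset_closedBall_of_isCompact hL hLb
    let ψ : C(K, ℂ) := ⟨K.domRestrict φ, continuousOn_iff_continuous_domRestrict.1 hφ⟩
    have key : ∀ (a : ℝ) (n : ℕ), ∃ r ∈ ρ, (a < 1 → a < r) ∧ 1 - 1 / ((n : ℝ) + 1) < r ∧
        (⨆ ζ ∈ K, ⨆ z ∈ L, ‖f.1 ((r : ℂ) * (ζ - z) + z) - φ ζ‖) ≤ 2 * (1 / ((n : ℝ) + 1)) := by
      intro a n
      have hd0 : 0 < 1 / ((n : ℝ) + 1) := by positivity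
      obtain ⟨j, hj⟩ := hΦ.exists_dist_lt ψ hd0
      obtain ⟨N, hnN, hN⟩ : ∃ N ≥ n, a < 1 → 1 / ((N : ℝ) + 1) < 1 - a := by
        by_cases ha : a < 1
        · obtain ⟨k, hk⟩ := exists_nat_one_div_lt (sub_pos.2 ha)
          refine ⟨max n k, le_max_left _ _, fun _ => lt_of_le_of_lt ?_ hk⟩
          gcongr; exact le_max_right _ _
        · exact ⟨n, le_rfl, fun h => absurd h ha⟩
      obtain ⟨r, hr, hrN, η, hη, h⟩ := hf j m N
      have hNn : 1 / ((N : ℝ) + 1) ≤ 1 / ((n : ℝ) + 1) := by gcongr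
      refine ⟨r, hr, fun ha => by linarith [hN ha], by linarith, ?_⟩
      refine Real.iSup_le (fun ζ => Real.iSup_le (fun hζ => Real.iSup_le (fun z =>
        Real.iSup_le (fun hz => ?_) ?_) ?_) ?_) ?_ <;> try positivity
      have h1 := h ⟨ζ, hζ⟩ z (hm hz)
      have h2 : dist (ψ ⟨ζ, hζ⟩) (Φ j ⟨ζ, hζ⟩) ≤ 1 / ((n : ℝ) + 1) :=
        (ContinuousMap.dist_apply_le_dist _).trans hj.le
      rw [dist_eq_norm, norm_sub_rev] at h2
      calc ‖f.1 ((r : ℂ) * (ζ - z) + z) - φ ζ‖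
          = ‖(f.1 ((r : ℂ) * (ζ - z) + z) - Φ j ⟨ζ, hζ⟩) + (Φ j ⟨ζ, hζ⟩ - ψ ⟨ζ, hζ⟩)‖ := by
            congr 1; simp only [ψ, ContinuousMap.coe_mk, domRestrict_apply]; ring
        _ ≤ 1 / ((n : ℝ) + 1) + 1 / ((n : ℝ) + 1) :=
            (norm_add_le _ _).trans (add_le_add (by linarith) h2)
        _ = _ := by ring
    choose R hRρ hRa hRn hRs using key
    let r : ℕ → ℝ := fun n => Nat.rec (R 0 0) (fun n a => R a (n + 1)) n
    have hr : ∀ n, ∃ a, r n = R a n := by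
      intro n; cases n with
      | zero => exact ⟨0, rfl⟩
      | succ n => exact ⟨r n, rfl⟩
    have hrρ : ∀ n, r n ∈ ρ := fun n => by
      obtain ⟨a, ha⟩ := hr n; rw [ha]; exact hRρ _ _
    have hlim := tendsto_one_div_add_atTop_nhds_zero_nat (𝕜 := ℝ)
    refine ⟨r, hrρ, strictMono_nat_of_lt_succ fun n => hRa (r n) (n + 1) (hρ (hrρ n)).2, ?_, ?_⟩
    · refine tendsto_of_tendsto_of_tendsto_of_le_of_le (g := fun n : ℕ => 1 - 1 / ((n : ℝ) + 1))
        (h := fun _ => 1) ?_ tendsto_const_nhds (fun n => ?_) (fun n => (hρ (hrρ n)).2.le)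
      · simpa using hlim.const_sub 1
      · obtain ⟨a, ha⟩ := hr n; rw [ha]; exact (hRn _ _).le
    · refine tendsto_of_tendsto_of_tendsto_of_le_of_le tendsto_const_nhds
        (h := fun n : ℕ => 2 * (1 / ((n : ℝ) + 1))) ?_ (fun n => ?_) (fun n => ?_)
      · simpa using hlim.const_mul 2
      · exact Real.iSup_nonneg fun _ => Real.iSup_nonneg fun _ => Real.iSup_nonneg fun _ =>
          Real.iSup_nonneg fun _ => norm_nonneg _
      · obtain ⟨a, ha⟩ := hr n; simp only [ha]; exact hRs _ _

theorem isGδ_dense_VAp_of_approx [hp : Fact (1 ≤ p)] {ρ : Set ℝ} (hρ : ρ ⊆ Ico (0:ℝ) 1)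
    (hρ1 : AccPt (1:ℝ) (𝓟 ρ)) {K : Set ℂ} (hKc : IsCompact K) (hKT : K ⊆ sphere (0:ℂ) 1)
    (happrox : ∀ (ψ : C(K, ℂ)) (f : ApSpace p) (ε : ℝ), 0 < ε → ∃ g : ApSpace p,
      ContinuousOn g.1 (closedBall 0 1) ∧ ‖g.toLp - f.toLp‖ < ε ∧ ∀ ζ : K, ‖g.1 ζ - ψ ζ‖ < ε) :
    IsGδ (VAp p ρ K) ∧ Dense (VAp p ρ K) := by
  have : CompactSpace K := isCompact_iff_compactSpace.1 hKc
  have := ApSpace.baireSpace (p := p)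
  rw [VAp_eq_iInter hρ hKc hKT (TopologicalSpace.denseRange_denseSeq C(K, ℂ))]
  exact ⟨.iInter_of_isOpen fun _ => isOpen_nearDilateSet hρ hKT _ _ _,
    dense_iInter_of_isOpen (fun _ => isOpen_nearDilateSet hρ hKT _ _ _)
      fun _ => dense_nearDilateSet hρ hρ1 hKT _ (happrox _) _ _⟩

end UniversalSet

theorem DiffContOnCl.mul_complex {f g : ℂ → ℂ} {s : Set ℂ} (hf : DiffContOnCl ℂ f s)
    (hg : DiffContOnCl ℂ g s) : DiffContOnCl ℂ (fun z => f z * g z) s :=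
  hf.smul hg

theorem DiffContOnCl.exists_bound {f : ℂ → ℂ} (hf : DiffContOnCl ℂ f (ball 0 1)) :
    ∃ B : ℝ, 0 < B ∧ ∀ z ∈ closedBall (0:ℂ) 1, ‖f z‖ ≤ B := by
  obtain ⟨B, hB⟩ := (isCompact_closedBall (0:ℂ) 1).exists_bound_of_continuousOn
    hf.continuousOn_ball
  exact ⟨max B 1, by positivity, fun z hz => (hB z hz).trans (le_max_left _ _)⟩

theorem DiffContOnCl.memAp {p : ℝ} (hp : 1 ≤ p) {f : ℂ → ℂ}
    (hf : DiffContOnCl ℂ f (ball 0 1)) : MemAp p f := by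
  rw [memAp_iff_memLp hp]
  refine ⟨hf.differentiableOn, ?_⟩
  obtain ⟨B, -, hB⟩ := hf.exists_bound
  refine MemLp.of_bound (hf.differentiableOn.continuousOn.aestronglyMeasurable
    measurableSet_ball) B ?_
  filter_upwards [ae_restrict_mem measurableSet_ball] with z hz
  exact hB z (ball_subset_closedBall hz)

/-- `K` is a peak-type set for the Bergman space: functions of the disk algebra can be close to
`1` in the Bergman norm and at the origin while being small on `K`. -/
def HasVanishingUnits (p : ℝ) (K : Set ℂ) : Prop :=
  ∀ ε : ℝ, 0 < ε → ∃ h : ℂ → ℂ, DiffContOnCl ℂ h (ball 0 1) ∧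
    eLpNorm (fun z => h z - 1) (ENNReal.ofReal p) diskMeasure ≤ ENNReal.ofReal ε ∧
    ‖h 0 - 1‖ ≤ ε ∧ ∀ ζ ∈ K, ‖h ζ‖ ≤ ε

theorem HasVanishingUnits.exists_approx_continuous {p : ℝ} {K : Set ℂ} (hKc : IsCompact K)
    (hKT : K ⊆ sphere (0:ℂ) 1) (hK : HasVanishingUnits p K) (ψ : C(K, ℂ)) :
    ∀ ε : ℝ, 0 < ε → ∃ q : ℂ → ℂ, DiffContOnCl ℂ q (ball 0 1) ∧ ∀ ζ : K, ‖q ζ - ψ ζ‖ < ε := by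
  have : CompactSpace K := isCompact_iff_compactSpace.1 hKc
  induction ψ using ContinuousMap.induction_on_of_compact with
  | const r => exact fun ε hε => ⟨fun _ => r, diffContOnCl_const, fun ζ => by simpa using hε⟩
  | id => exact fun ε hε => ⟨id, differentiable_id.diffContOnCl, fun ζ => by simpa using hε⟩
  | star_id =>
    intro ε hε
    obtain ⟨h, hd, -, h0, hs⟩ := hK (min (1 / 2) (ε / 4)) (by positivity)
    have h0' : 1 / 2 ≤ ‖h 0‖ := by
      have h1 : ‖(1:ℂ)‖ - ‖h 0‖ ≤ ‖(1:ℂ) - h 0‖ := norm_sub_norm_le _ _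
      rw [norm_sub_rev, norm_one] at h1
      have := h0.trans (min_le_left _ _)
      linarith
    have h00 : h 0 ≠ 0 := by
      intro h; rw [h, norm_zero] at h0'; linarith
    refine ⟨fun z => -(h 0)⁻¹ * dslope h 0 z, ?_, fun ζ => ?_⟩
    · refine diffContOnCl_const.mul_complex ⟨?_, ?_⟩
      · exact (differentiableOn_dslope (ball_mem_nhds _ one_pos)).2 hd.differentiableOn
      · rw [closure_ball _ one_ne_zero]
        exact (continuousOn_dslope (closedBall_mem_nhds _ one_pos)).2
          ⟨hd.continuousOn_ball, hd.differentiableOn.differentiableAt (ball_mem_nhds _ one_pos)⟩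
    · have hζ : ‖(ζ : ℂ)‖ = 1 := by simpa using hKT ζ.2
      have hζ0 : (ζ : ℂ) ≠ 0 := by
        intro h; rw [h, norm_zero] at hζ; linarith
      have hst : star (ζ : ℂ) = (ζ : ℂ)⁻¹ := by
        rw [Complex.inv_def, normSq_eq_norm_sq, hζ]; simp
      have e : -(h 0)⁻¹ * dslope h 0 ζ - star (ζ : ℂ) = -(h 0)⁻¹ * h ζ * (ζ : ℂ)⁻¹ := by
        rw [hst, dslope_of_ne _ hζ0, slope_def_field]
        field_simp; ring
      change ‖-(h 0)⁻¹ * dslope h 0 ζ - star (ζ : ℂ)‖ < ε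
      rw [e, norm_mul, norm_mul, norm_neg, norm_inv, norm_inv, hζ, inv_one, mul_one]
      have h1 : ‖h 0‖⁻¹ ≤ 2 := by
        rw [inv_le_comm₀ (by linarith) (by norm_num)]; linarith
      have h2 := (hs ζ ζ.2).trans (min_le_right _ _)
      have h3 : 0 ≤ ‖h ζ‖ := norm_nonneg _
      nlinarith
  | add f g hf hg =>
    intro ε hε
    obtain ⟨q, hq, hqf⟩ := hf (ε / 2) (half_pos hε)
    obtain ⟨q', hq', hqg⟩ := hg (ε / 2) (half_pos hε)
    refine ⟨q + q', hq.add hq', fun ζ => ?_⟩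
    calc ‖(q + q') ζ - (f + g) ζ‖ = ‖(q ζ - f ζ) + (q' ζ - g ζ)‖ := by
          congr 1; simp only [Pi.add_apply, ContinuousMap.add_apply]; ring
      _ < ε := (norm_add_le _ _).trans_lt (by linarith [hqf ζ, hqg ζ])
  | mul f g hf hg =>
    intro ε hε
    set d := min 1 (ε / (‖f‖ + ‖g‖ + 2)) with hd
    have hd0 : 0 < d := by positivity
    have hd1 : d ≤ 1 := min_le_left _ _
    have hd2 : d * (‖f‖ + ‖g‖ + 2) ≤ ε := by
      rw [← le_div_iff₀ (by positivity)]; exact min_le_right _ _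
    obtain ⟨q, hq, hqf⟩ := hf d hd0
    obtain ⟨q', hq', hqg⟩ := hg d hd0
    refine ⟨_, hq.mul_complex hq', fun ζ => ?_⟩
    have h1 : ‖q' ζ‖ ≤ ‖g‖ + 1 := by
      have h2 : ‖q' ζ‖ ≤ ‖q' ζ - g ζ‖ + ‖g ζ‖ := by
        simpa using norm_add_le (q' ζ - g ζ) (g ζ)
      linarith [hqg ζ, g.norm_coe_le_norm ζ]
    have h3 := f.norm_coe_le_norm ζ
    calc ‖q ζ * q' ζ - (f * g) ζ‖ = ‖(q ζ - f ζ) * q' ζ + f ζ * (q' ζ - g ζ)‖ := by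
          congr 1; simp only [ContinuousMap.mul_apply]; ring
      _ ≤ ‖q ζ - f ζ‖ * ‖q' ζ‖ + ‖f ζ‖ * ‖q' ζ - g ζ‖ := by
          refine (norm_add_le _ _).trans ?_
          rw [norm_mul, norm_mul]
      _ ≤ d * (‖g‖ + 1) + ‖f‖ * d := by
          gcongr
          · exact (hqf ζ).le
          · exact (hqg ζ).le
      _ < ε := by nlinarith
  | frequently f hf =>
    intro ε hε
    obtain ⟨g, hg, hgd⟩ := (hf.and_eventually (ball_mem_nhds f (half_pos hε))).exists
    obtain ⟨q, hq, hqg⟩ := hg (ε / 2) (half_pos hε)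
    refine ⟨q, hq, fun ζ => ?_⟩
    have h1 : dist (g ζ) (f ζ) < ε / 2 := (ContinuousMap.dist_apply_le_dist ζ).trans_lt hgd
    rw [dist_eq_norm] at h1
    calc ‖q ζ - f ζ‖ = ‖(q ζ - g ζ) + (g ζ - f ζ)‖ := by congr 1; ring
      _ < ε := (norm_add_le _ _).trans_lt (by linarith [hqg ζ])

theorem eLpNorm_comp_mul_le {p : ℝ} (hp : 1 ≤ p) (F : ℂ → ℂ) {s : ℝ} (hs : 1 / 2 ≤ s) :
    eLpNorm (fun z => F ((s : ℂ) * z)) (ENNReal.ofReal p) volume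
      ≤ 4 * eLpNorm F (ENNReal.ofReal p) volume := by
  have hs0 : s ≠ 0 := by linarith
  have hme : MeasurableEmbedding (fun z : ℂ => s • z) :=
    (Homeomorph.smulOfNeZero s hs0).measurableEmbedding
  have h1 : (fun z : ℂ => F ((s : ℂ) * z)) = F ∘ (fun z : ℂ => s • z) := by
    ext z; simp
  rw [h1, ← hme.eLpNorm_map_measure, Measure.map_addHaar_smul _ hs0,
    eLpNorm_smul_measure_of_ne_top ENNReal.ofReal_ne_top, finrank_real_complex, smul_eq_mul]
  gcongr
  have h2 : (ENNReal.ofReal |(s ^ 2)⁻¹|) ≤ 4 := by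
    rw [abs_of_nonneg (by positivity)]
    have : (s ^ 2)⁻¹ ≤ 4 := by
      rw [inv_le_comm₀ (by positivity) (by norm_num)]; nlinarith
    simpa using ENNReal.ofReal_le_ofReal this
  refine (ENNReal.rpow_le_rpow h2 ENNReal.toReal_nonneg).trans ?_
  calc (4:ENNReal) ^ (1 / ENNReal.ofReal p).toReal ≤ 4 ^ (1:ℝ) := by
        apply ENNReal.rpow_le_rpow_of_exponent_le (by norm_num)
        rw [ENNReal.toReal_div, ENNReal.toReal_ofReal (by linarith)]
        simp only [ENNReal.toReal_one, one_div]
        exact inv_le_one_of_one_le₀ hp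
    _ = 4 := by simp

theorem MemAp.exists_diffContOnCl_approx {p : ℝ} (hp : 1 ≤ p) {f : ℂ → ℂ} (hf : MemAp p f)
    {ε : ℝ} (hε : 0 < ε) : ∃ g : ℂ → ℂ, DiffContOnCl ℂ g (ball 0 1) ∧
      eLpNorm (g - f) (ENNReal.ofReal p) diskMeasure ≤ ENNReal.ofReal ε := by
  have hp1 : 1 ≤ ENNReal.ofReal p := by simpa using ENNReal.ofReal_le_ofReal hp
  obtain ⟨hfd, hfL⟩ := (memAp_iff_memLp hp).1 hf
  set F := (ball (0:ℂ) 1).indicator f with hF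
  have hFL : MemLp F (ENNReal.ofReal p) volume :=
    (memLp_indicator_iff_restrict measurableSet_ball).2 hfL
  set d := ε / 6 with hd
  have hd0 : 0 < d := by positivity
  obtain ⟨g, hgs, hgF, hgc, hgL⟩ := hFL.exists_hasCompactSupport_eLpNorm_sub_le
    ENNReal.ofReal_ne_top (ENNReal.ofReal_pos.2 hd0).ne'
  have hFm : AEStronglyMeasurable F volume := hFL.1
  obtain ⟨M, hM⟩ : ∃ M : ℝ, (diskMeasure univ) ^ (ENNReal.ofReal p).toReal⁻¹ = ENNReal.ofReal M ∧
      0 ≤ M := by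
    refine ⟨_, (ENNReal.ofReal_toReal ?_).symm, ENNReal.toReal_nonneg⟩
    exact ENNReal.rpow_ne_top_of_nonneg (by positivity) (measure_ne_top _ _)
  have huc := hgs.uniformContinuous_of_continuous hgc
  rw [Metric.uniformContinuous_iff] at huc
  obtain ⟨δ, hδ, hu⟩ := huc (d / (M + 1)) (by have := hM.2; positivity)
  set s : ℝ := max (1 / 2) (1 - δ / 2) with hs
  have hs1 : 1 / 2 ≤ s := le_max_left _ _
  have hs2 : 1 - δ / 2 ≤ s := le_max_right _ _
  have hs3 : s < 1 := max_lt (by norm_num) (by linarith)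
  have hmap : MapsTo (fun z : ℂ => (s : ℂ) * z) (closedBall 0 1) (ball 0 1) := by
    intro z hz
    have : ‖z‖ ≤ 1 := by simpa using hz
    simp only [mem_ball_zero_iff, norm_mul, norm_real, Real.norm_of_nonneg (by linarith : 0 ≤ s)]
    nlinarith [norm_nonneg z]
  refine ⟨fun z => f ((s : ℂ) * z), ⟨?_, ?_⟩, ?_⟩
  · exact hfd.comp (by fun_prop) (hmap.mono_left ball_subset_closedBall)
  · rw [closure_ball _ one_ne_zero]
    exact hfd.continuousOn.comp (by fun_prop) hmap
  set A : ℂ → ℂ := fun z => (F - g) ((s : ℂ) * z) with hA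
  set B : ℂ → ℂ := fun z => g ((s : ℂ) * z) - g z with hB
  have hsum : ((fun z => f ((s : ℂ) * z)) - f) =ᵐ[diskMeasure] A + (B + (g - F)) := by
    filter_upwards [ae_restrict_mem measurableSet_ball] with z hz
    have h1 : F z = f z := indicator_of_mem hz _
    have h2 : F ((s : ℂ) * z) = f ((s : ℂ) * z) :=
      indicator_of_mem (hmap (ball_subset_closedBall hz)) _
    simp only [Pi.sub_apply, Pi.add_apply, hA, hB, h1, h2]; ring
  have hBm : AEStronglyMeasurable B diskMeasure :=
    Continuous.aestronglyMeasurable (by fun_prop)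
  have hDm : AEStronglyMeasurable (g - F) diskMeasure :=
    (hgL.1.sub hFm).mono_measure Measure.restrict_le_self
  have hAm : AEStronglyMeasurable A diskMeasure := by
    have h1 : AEStronglyMeasurable (fun z => f ((s : ℂ) * z)) diskMeasure :=
      (hfd.continuousOn.comp (by fun_prop) (hmap.mono_left ball_subset_closedBall)
        : ContinuousOn (fun z => f ((s : ℂ) * z)) (ball 0 1)).aestronglyMeasurable
          measurableSet_ball
    have h2 : AEStronglyMeasurable (fun z => g ((s : ℂ) * z)) diskMeasure :=
      Continuous.aestronglyMeasurable (by fun_prop)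
    refine (h1.sub h2).congr ?_
    filter_upwards [ae_restrict_mem measurableSet_ball] with z hz
    have h2 : F ((s : ℂ) * z) = f ((s : ℂ) * z) :=
      indicator_of_mem (hmap (ball_subset_closedBall hz)) _
    simp only [Pi.sub_apply, hA, h2]
  have eA : eLpNorm A (ENNReal.ofReal p) diskMeasure ≤ 4 * ENNReal.ofReal d :=
    (eLpNorm_mono_measure _ Measure.restrict_le_self).trans
      ((eLpNorm_comp_mul_le hp (F - g) hs1).trans (by gcongr))
  have eB : eLpNorm B (ENNReal.ofReal p) diskMeasure ≤ ENNReal.ofReal d := by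
    have h1 : ∀ᵐ z ∂diskMeasure, ‖B z‖ ≤ d / (M + 1) := by
      filter_upwards [ae_restrict_mem measurableSet_ball] with z hz
      have hz1 : ‖z‖ < 1 := by simpa using hz
      have h2 : dist ((s : ℂ) * z) z < δ := by
        have : (s : ℂ) * z - z = -(((1 - s : ℝ) : ℂ) * z) := by push_cast; ring
        rw [dist_eq_norm, this, norm_neg, norm_mul, norm_real,
          Real.norm_of_nonneg (by linarith)]
        nlinarith [norm_nonneg z]
      have := hu h2
      rw [dist_eq_norm] at this
      exact this.le
    refine (eLpNorm_le_of_ae_bound h1).trans ?_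
    rw [hM.1, ← ENNReal.ofReal_mul hM.2]
    apply ENNReal.ofReal_le_ofReal
    have := hM.2
    rw [mul_div_assoc', div_le_iff₀ (by positivity)]; nlinarith
  have eD : eLpNorm (g - F) (ENNReal.ofReal p) diskMeasure ≤ ENNReal.ofReal d := by
    rw [eLpNorm_sub_comm]
    exact (eLpNorm_mono_measure _ Measure.restrict_le_self).trans hgF
  rw [eLpNorm_congr_ae hsum]
  refine (eLpNorm_add_le hAm (hBm.add hDm) hp1).trans ?_
  refine (add_le_add eA ((eLpNorm_add_le hBm hDm hp1).trans (add_le_add eB eD))).trans ?_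
  have : (4:ENNReal) = ENNReal.ofReal 4 := by simp
  rw [this, ← ENNReal.ofReal_mul (by norm_num), ← ENNReal.ofReal_add hd0.le hd0.le,
    ← ENNReal.ofReal_add (by positivity) (by positivity)]
  apply ENNReal.ofReal_le_ofReal
  rw [hd]; linarith

theorem HasVanishingUnits.exists_approx {p : ℝ} [hp : Fact (1 ≤ p)] {K : Set ℂ}
    (hKc : IsCompact K) (hKT : K ⊆ sphere (0:ℂ) 1) (hK : HasVanishingUnits p K)
    (ψ : C(K, ℂ)) (f : ApSpace p) (ε : ℝ) (hε : 0 < ε) : ∃ g : ApSpace p,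
      ContinuousOn g.1 (closedBall 0 1) ∧ ‖g.toLp - f.toLp‖ < ε ∧ ∀ ζ : K, ‖g.1 ζ - ψ ζ‖ < ε := by
  obtain ⟨f₁, hf₁, hff₁⟩ := f.2.exists_diffContOnCl_approx hp.out (ε := ε / 3) (by positivity)
  obtain ⟨q, hq, hqψ⟩ := hK.exists_approx_continuous hKc hKT ψ (ε / 3) (by positivity)
  obtain ⟨B, hB0, hB⟩ := (hf₁.sub hq).exists_bound
  obtain ⟨h, hh, hh1, -, hhK⟩ := hK (ε / (3 * B)) (by positivity)
  have hBε : B * (ε / (3 * B)) = ε / 3 := by field_simp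
  have hg : DiffContOnCl ℂ (fun z => q z + h z * (f₁ - q) z) (ball 0 1) :=
    hq.add (hh.mul_complex (hf₁.sub hq))
  have hgA := hg.memAp hp.out
  have hf₁A := hf₁.memAp hp.out
  obtain ⟨g, hgq⟩ : ∃ g : ApSpace p, g.1 = fun z => q z + h z * (f₁ - q) z := ⟨⟨_, hgA⟩, rfl⟩
  refine ⟨g, by rw [hgq]; exact hg.continuousOn_ball, ?_, fun ζ => ?_⟩
  · rw [ApSpace.norm_toLp_sub, hgq]
    apply ENNReal.toReal_lt_of_lt_ofReal
    have e : (fun z => q z + h z * (f₁ - q) z) - f.1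
        = (fun z => (h z - 1) * (f₁ - q) z) + (f₁ - f.1) := by
      ext z; simp only [Pi.sub_apply, Pi.add_apply]; ring
    have m1 : MemLp (fun z => (h z - 1) * (f₁ - q) z) (ENNReal.ofReal p) diskMeasure :=
      ((memAp_iff_memLp hp.out).1 (((hh.sub diffContOnCl_const).mul_complex
        (hf₁.sub hq)).memAp hp.out)).2
    have m2 : MemLp (f₁ - f.1) (ENNReal.ofReal p) diskMeasure :=
      ((memAp_iff_memLp hp.out).1 (hf₁A.sub hp.out f.2)).2
    rw [e]
    refine (eLpNorm_add_le m1.1 m2.1 Fact.out).trans_lt ?_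
    have e1 : eLpNorm (fun z => (h z - 1) * (f₁ - q) z) (ENNReal.ofReal p) diskMeasure
        ≤ ENNReal.ofReal (ε / 3) := by
      have : ∀ᵐ z ∂diskMeasure, ‖(h z - 1) * (f₁ - q) z‖ ≤ B * ‖h z - 1‖ := by
        filter_upwards [ae_restrict_mem measurableSet_ball] with z hz
        rw [norm_mul, mul_comm]
        gcongr
        exact hB z (ball_subset_closedBall hz)
      refine (eLpNorm_le_mul_eLpNorm_of_ae_le_mul this _).trans ?_
      rw [← hBε, ENNReal.ofReal_mul hB0.le]
      gcongr
    refine (add_le_add e1 hff₁).trans_lt ?_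
    rw [← ENNReal.ofReal_add (by positivity) (by positivity)]
    exact (ENNReal.ofReal_lt_ofReal_iff hε).2 (by linarith)
  · have hζ : (ζ : ℂ) ∈ closedBall (0:ℂ) 1 := sphere_subset_closedBall (hKT ζ.2)
    have h1 : ‖h ζ * (f₁ - q) ζ‖ ≤ ε / 3 := by
      rw [norm_mul, ← hBε, mul_comm]
      gcongr
      · exact hB ζ hζ
      · exact hhK ζ ζ.2
    rw [hgq]
    calc ‖q ζ + h ζ * (f₁ - q) ζ - ψ ζ‖ = ‖(q ζ - ψ ζ) + h ζ * (f₁ - q) ζ‖ := by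
          congr 1; ring
      _ < ε := (norm_add_le _ _).trans_lt (by linarith [hqψ ζ])

/-- The parametrisation `x ↦ e^{2πix}` of the unit circle. -/
def circlePoint (x : ℝ) : ℂ := Complex.exp (((2 * Real.pi * x : ℝ) : ℂ) * I)

theorem norm_circlePoint (x : ℝ) : ‖circlePoint x‖ = 1 := norm_exp_ofReal_mul_I _

theorem continuous_circlePoint : Continuous circlePoint := by
  unfold circlePoint; fun_prop

theorem circlePoint_eq_iff {x y : ℝ} : circlePoint x = circlePoint y ↔ ∃ n : ℤ, x = y + n := by
  rw [circlePoint, circlePoint, exp_eq_exp_iff_exists_int]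
  refine exists_congr fun n => ?_
  have : (((2 * Real.pi * x : ℝ) : ℂ) * I = ((2 * Real.pi * y : ℝ) : ℂ) * I
      + n * (2 * Real.pi * I)) ↔ ((2 * Real.pi * I : ℂ) * (x : ℝ) = (2 * Real.pi * I : ℂ)
        * ((y + n : ℝ) : ℂ)) := by
    push_cast
    constructor <;> intro h <;> linear_combination h
  rw [this, mul_right_inj' two_pi_I_ne_zero, ofReal_inj]

theorem exists_circlePoint_eq {z : ℂ} (hz : ‖z‖ = 1) (a : ℝ) :
    ∃ x ∈ Ico a (a + 1), circlePoint x = z := by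
  refine ⟨toIcoMod one_pos a (arg z / (2 * Real.pi)), toIcoMod_mem_Ico _ _ _, ?_⟩
  have h1 : circlePoint (arg z / (2 * Real.pi)) = z := by
    rw [circlePoint, mul_div_cancel₀ _ (by positivity)]
    simpa [hz] using norm_mul_exp_arg_mul_I z
  rw [← h1, toIcoMod, circlePoint_eq_iff]
  exact ⟨-toIcoDiv one_pos a (arg (circlePoint (arg z / (2 * Real.pi))) / (2 * Real.pi)), by
    rw [h1]; simp [sub_eq_add_neg]⟩

theorem circlePoint_injOn (a : ℝ) : InjOn circlePoint (Ico a (a + 1)) := by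
  intro x hx y hy h
  obtain ⟨n, hn⟩ := circlePoint_eq_iff.1 h
  have h1 : (n : ℝ) < 1 := by linarith [hx.2, hy.1]
  have h2 : (-1 : ℝ) < n := by linarith [hx.1, hy.2]
  have : n = 0 := by
    have h1' : n < 1 := by exact_mod_cast h1
    have h2' : -1 < n := by exact_mod_cast h2
    omega
  simpa [this] using hn

theorem exp_ofReal_mul_I_eq_circlePoint (θ : ℝ) :
    Complex.exp ((θ : ℂ) * I) = circlePoint (θ / (2 * Real.pi)) := by
  rw [circlePoint, mul_div_cancel₀ _ (by positivity)]

open scoped Pointwise in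
theorem arcMeasure_image_circlePoint {a : ℝ} {S : Set ℝ} (hS : MeasurableSet S)
    (hSa : S ⊆ Ico a (a + 1)) :
    arcMeasure (circlePoint '' S) = ENNReal.ofReal (2 * Real.pi) * volume S := by
  have hpi : 0 < 2 * Real.pi := by positivity
  set A : Set ℝ := {θ | Complex.exp ((θ : ℂ) * I) ∈ circlePoint '' S} with hA
  have hA' : A = ⋃ n : ℤ, (fun θ : ℝ => θ / (2 * Real.pi) - n) ⁻¹' S := by
    ext θ
    simp only [hA, exp_ofReal_mul_I_eq_circlePoint, mem_image, mem_iUnion, mem_preimage,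
      Set.mem_ofPred_eq]
    constructor
    · rintro ⟨x, hx, h⟩
      obtain ⟨n, hn⟩ := circlePoint_eq_iff.1 h.symm
      exact ⟨n, by rw [hn]; simpa using hx⟩
    · rintro ⟨n, hn⟩
      exact ⟨_, hn, circlePoint_eq_iff.2 ⟨-n, by push_cast; ring⟩⟩
  have hAm : MeasurableSet A := by
    rw [hA']
    exact MeasurableSet.iUnion fun n => (by fun_prop : Measurable fun θ : ℝ =>
      θ / (2 * Real.pi) - n) hS
  have key := (isAddFundamentalDomain_Ioc hpi 0).measure_set_eq
    (isAddFundamentalDomain_Ioc hpi (2 * Real.pi * a)) hAm ?_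
  · have h1 : arcMeasure (circlePoint '' S) = volume (A ∩ Ico 0 (2 * Real.pi)) := by
      rw [arcMeasure]; congr 1; ext θ; exact and_comm
    have h2 : A ∩ Ico (2 * Real.pi * a) (2 * Real.pi * a + 2 * Real.pi)
        = (2 * Real.pi) • S := by
      ext θ
      rw [mem_smul_set_iff_inv_smul_mem₀ hpi.ne', smul_eq_mul, mem_inter_iff, hA,
        Set.mem_ofPred_eq, exp_ofReal_mul_I_eq_circlePoint, ← div_eq_inv_mul]
      have h3 : θ ∈ Ico (2 * Real.pi * a) (2 * Real.pi * a + 2 * Real.pi)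
          ↔ θ / (2 * Real.pi) ∈ Ico a (a + 1) := by
        rw [mem_Ico, mem_Ico, le_div_iff₀ hpi, div_lt_iff₀ hpi]
        constructor <;> rintro ⟨h, h'⟩ <;> constructor <;> linarith
      rw [h3]
      constructor
      · rintro ⟨⟨x, hx, h⟩, h'⟩
        rwa [← circlePoint_injOn a (hSa hx) h' h]
      · intro h
        exact ⟨⟨_, h, rfl⟩, hSa h⟩
    rw [h1, measure_congr ((ae_eq_refl A).inter Ico_ae_eq_Ioc)]
    simp only [zero_add] at key
    rw [key, ← measure_congr ((ae_eq_refl A).inter Ico_ae_eq_Ioc), h2,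
      Measure.addHaar_smul]
    simp [abs_of_pos Real.pi_pos]
  · rintro ⟨g, hg⟩
    obtain ⟨n, rfl⟩ := AddSubgroup.mem_zmultiples_iff.1 hg
    ext θ
    simp only [hA, mem_preimage, Set.mem_ofPred_eq, exp_ofReal_mul_I_eq_circlePoint]
    have : circlePoint (((⟨n • (2 * Real.pi), hg⟩ : AddSubgroup.zmultiples (2 * Real.pi)) +ᵥ θ)
        / (2 * Real.pi)) = circlePoint (θ / (2 * Real.pi)) := by
      rw [circlePoint_eq_iff]
      refine ⟨n, ?_⟩
      rw [AddSubgroup.vadd_def]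
      simp only [vadd_eq_add, zsmul_eq_mul]
      field_simp
      ring
    rw [this]


theorem IsOpen.eq_Ioo_of_isPreconnected {C : Set ℝ} (hC : IsOpen C) (hC' : IsPreconnected C)
    (hne : C.Nonempty) (hb : BddBelow C) (hb' : BddAbove C) : C = Ioo (sInf C) (sSup C) := by
  refine Subset.antisymm (fun x hx => ⟨?_, ?_⟩)
    (IsConnected.Ioo_csInf_csSup_subset ⟨hne, hC'⟩ hb hb')
  · obtain ⟨y, hy, hyx⟩ := (mem_nhds_iff_exists_Ioo_subset.1 (hC.mem_nhds hx)).imp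
      fun l ⟨u, h, hs⟩ => (⟨h.1, fun y hy => hs ⟨hy.1, hy.2.trans h.2⟩⟩ :
        l < x ∧ Ioo l x ⊆ C)
    obtain ⟨z, hz⟩ := exists_between hy
    exact (csInf_le hb (hyx hz)).trans_lt hz.2
  · obtain ⟨u, ⟨y, hy⟩, hs⟩ : ∃ u, (∃ y, x < y ∧ y < u) ∧ Ioo x u ⊆ C := by
      obtain ⟨l, u, h, hs⟩ := mem_nhds_iff_exists_Ioo_subset.1 (hC.mem_nhds hx)
      exact ⟨u, exists_between h.2, fun y hy => hs ⟨h.1.trans hy.1, hy.2⟩⟩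
    exact hy.1.trans_le (le_csSup hb' (hs hy))

theorem isOpenArc_circlePoint {s t : ℝ} (hst : s < t) (ht : t ≤ s + 1) :
    IsOpenArc (circlePoint '' Ioo s t) := by
  have hpi : 0 < 2 * Real.pi := by positivity
  refine ⟨2 * Real.pi * s, 2 * Real.pi * t, by gcongr, by nlinarith, ?_⟩
  have : Ioo (2 * Real.pi * s) (2 * Real.pi * t) = (fun x => 2 * Real.pi * x) '' Ioo s t :=
    (Set.image_mul_left_Ioo hpi s t).symm
  rw [this, image_image]
  rfl

theorem satisfiesCarleson_image_circlePoint {E : Set ℝ} {a : ℝ} (hE : IsClosed E) (ha : a ∈ E)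
    (hEa : E ⊆ Ico a (a + 1)) {G : ℝ → ENNReal} (hG : ∫⁻ x in Ioo a (a + 1) \ E, G x ≠ ⊤)
    (h : ∀ᵐ x, x ∈ Ioo a (a + 1) \ E → ENNReal.ofReal
      (-Real.log (volume (connectedComponentIn (Ioo a (a + 1) \ E) x)).toReal) ≤ G x) :
    SatisfiesCarleson (circlePoint '' E) := by
  set U := Ioo a (a + 1) \ E with hU
  have hUo : IsOpen U := isOpen_Ioo.sdiff hE
  set S : Set (Set ℝ) := {C | ∃ x ∈ U, C = connectedComponentIn U x} with hS
  have hSo : ∀ C ∈ S, IsOpen C := by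
    rintro _ ⟨x, -, rfl⟩; exact hUo.connectedComponentIn
  have hSU : ∀ C ∈ S, C ⊆ U := by
    rintro _ ⟨x, -, rfl⟩; exact connectedComponentIn_subset _ _
  have hSne : ∀ C ∈ S, C.Nonempty := by
    rintro _ ⟨x, hx, rfl⟩; exact ⟨x, mem_connectedComponentIn hx⟩
  have hSx : ∀ C ∈ S, ∀ x ∈ C, C = connectedComponentIn U x := by
    rintro _ ⟨y, hy, rfl⟩ x hx; exact connectedComponentIn_eq hx
  have hSd : S.PairwiseDisjoint id := by
    intro C hC D hD hCD
    refine Set.disjoint_left.2 fun x hx hx' => hCD ?_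
    rw [hSx C hC x hx, ← hSx D hD x hx']
  have hSc : S.Countable := hSd.countable_of_isOpen hSo hSne
  have hUS : U = ⋃₀ S := by
    refine Subset.antisymm (fun x hx => ⟨_, ⟨x, hx, rfl⟩, mem_connectedComponentIn hx⟩)
      (sUnion_subset hSU)
  have hIoo : ∀ C ∈ S, ∃ s t, s < t ∧ t ≤ s + 1 ∧ C = Ioo s t := by
    intro C hC
    have hCU : C ⊆ Ioo a (a + 1) := (hSU C hC).trans sdiff_subset
    have e := (hSo C hC).eq_Ioo_of_isPreconnected (by
      obtain ⟨x, -, rfl⟩ := hC; exact isPreconnected_connectedComponentIn) (hSne C hC)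
      (bddBelow_Ioo.mono hCU) (bddAbove_Ioo.mono hCU)
    have hlt : sInf C < sSup C := by
      have := hSne C hC
      rw [e] at this
      exact nonempty_Ioo.1 this
    refine ⟨_, _, hlt, ?_, e⟩
    rw [e, Ioo_subset_Ioo_iff hlt] at hCU
    linarith
  have : Encodable S := hSc.toEncodable
  set B : ℕ → Set ℝ := fun k => ⋃ C ∈ Encodable.decode₂ S k, (C : Set ℝ) with hB
  have hBS : ∀ k, B k ∈ S ∨ B k = ∅ := fun k => by
    refine Encodable.iUnion_decode₂_cases (C := fun s => s ∈ S ∨ s = ∅) (Or.inr rfl)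
      (fun C => Or.inl C.2)
  have hBd : Pairwise (Function.onFun Disjoint B) :=
    Encodable.iUnion_decode₂_disjoint_on fun C D hCD =>
      hSd C.2 D.2 (fun h => hCD (Subtype.ext h))
  have hBU : U = ⋃ k, B k := by
    rw [hUS, hB, Encodable.iUnion_decode₂, sUnion_eq_iUnion]
  have hBsub : ∀ k, B k ⊆ U := fun k => by rw [hBU]; exact subset_iUnion _ _
  have hBm : ∀ k, MeasurableSet (B k) := fun k => by
    rcases hBS k with h | h
    · exact (hSo _ h).measurableSet
    · rw [h]; exact MeasurableSet.empty
  have hUI : U ⊆ Ico a (a + 1) := sdiff_subset.trans Ioo_subset_Ico_self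
  have hinj := circlePoint_injOn a
  refine ⟨fun k => circlePoint '' B k, fun k => ?_, fun j k hjk => ?_, ?_, ?_⟩
  · rcases hBS k with h | h
    · obtain ⟨s, t, hst, ht, e⟩ := hIoo _ h
      simp only [e]
      exact Or.inl (isOpenArc_circlePoint hst ht)
    · right; simp [h]
  · refine disjoint_image_image fun x hx y hy hxy => ?_
    rw [hinj (hUI (hBsub j hx)) (hUI (hBsub k hy)) hxy] at hx
    exact Set.disjoint_left.1 (hBd hjk) hx hy
  · rw [← image_iUnion, ← hBU]
    ext z
    constructor
    · rintro ⟨hz, hzE⟩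
      obtain ⟨x, hx, rfl⟩ := exists_circlePoint_eq (mem_sphere_zero_iff_norm.1 hz) a
      have hxE : x ∉ E := fun h => hzE ⟨x, h, rfl⟩
      refine ⟨x, ⟨⟨lt_of_le_of_ne hx.1 ?_, hx.2⟩, hxE⟩, rfl⟩
      rintro rfl; exact hxE ha
    · rintro ⟨x, hx, rfl⟩
      refine ⟨mem_sphere_zero_iff_norm.2 (norm_circlePoint x), ?_⟩
      rintro ⟨y, hy, hxy⟩
      rw [hinj (hEa hy) (hUI hx) hxy] at hy
      exact hx.2 hy
  · set L : ℕ → ℝ := fun k => (volume (B k)).toReal with hL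
    have hUfin : volume U ≠ ⊤ :=
      ((measure_mono hUI).trans_lt measure_Ico_lt_top).ne
    have hL1 : Summable L := by
      apply ENNReal.summable_toReal
      rw [← measure_iUnion hBd hBm, ← hBU]
      exact hUfin
    have hg : Summable fun k => (∫⁻ x in B k, G x).toReal := by
      apply ENNReal.summable_toReal
      rw [← lintegral_iUnion hBm hBd, ← hBU]
      exact hG
    have hLle : ∀ k, L k ≤ 1 := fun k => by
      have : volume (B k) ≤ volume (Ico a (a + 1)) := measure_mono ((hBsub k).trans hUI)
      rw [Real.volume_Ico, add_sub_cancel_left] at this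
      exact ENNReal.toReal_le_of_le_ofReal zero_le_one this
    have hL0 : ∀ k, 0 ≤ L k := fun k => ENNReal.toReal_nonneg
    have hlog : Summable fun k => L k * -Real.log (L k) := by
      refine hg.of_nonneg_of_le (fun k => mul_nonneg (hL0 k)
        (neg_nonneg.2 (Real.log_nonpos (hL0 k) (hLle k)))) fun k => ?_
      have hBtop : volume (B k) ≠ ⊤ := ((measure_mono (hBsub k)).trans_lt hUfin.lt_top).ne
      have h1 : ∫⁻ x in B k, ENNReal.ofReal (-Real.log (L k)) ≤ ∫⁻ x in B k, G x := by
        refine lintegral_mono_ae ?_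
        filter_upwards [ae_restrict_of_ae h, ae_restrict_mem (hBm k)] with x hx hxk
        have hBk : B k ∈ S := (hBS k).resolve_right (Set.Nonempty.ne_empty ⟨x, hxk⟩)
        rw [hL]
        simp only
        rw [hSx _ hBk x hxk]
        exact hx (hBsub k hxk)
      rw [lintegral_const, Measure.restrict_apply_univ] at h1
      have h2 := ENNReal.toReal_mono
        ((lintegral_mono_set (hBsub k)).trans_lt hG.lt_top).ne h1
      rwa [ENNReal.toReal_mul, ENNReal.toReal_ofReal
        (neg_nonneg.2 (Real.log_nonpos (hL0 k) (hLle k))), mul_comm] at h2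
    refine ((hlog.mul_left (2 * Real.pi)).sub
      (hL1.mul_left (2 * Real.pi * Real.log (2 * Real.pi)))).congr fun k => ?_
    rw [arcMeasure_image_circlePoint (hBm k) ((hBsub k).trans hUI), ENNReal.toReal_mul,
      ENNReal.toReal_ofReal (by positivity)]
    change _ = 2 * Real.pi * L k * Real.log (1 / (2 * Real.pi * L k))
    rcases (hL0 k).eq_or_lt with h0 | h0
    · simp [← h0]
    · rw [one_div, Real.log_inv, Real.log_mul (by positivity) h0.ne']
      ring

/-- The dyadic interval of generation `m` with index `k`. -/
def dyadicIco (m : ℕ) (k : ℤ) : Set ℝ := Ico (k / 2 ^ m : ℝ) ((k + 1) / 2 ^ m)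

theorem mem_dyadicIco {m : ℕ} {k : ℤ} {x : ℝ} : x ∈ dyadicIco m k ↔ ⌊x * 2 ^ m⌋ = k := by
  rw [dyadicIco, mem_Ico, div_le_iff₀ (by positivity), lt_div_iff₀ (by positivity),
    Int.floor_eq_iff]

theorem measurableSet_dyadicIco (m : ℕ) (k : ℤ) : MeasurableSet (dyadicIco m k) :=
  measurableSet_Ico

theorem volume_dyadicIco (m : ℕ) (k : ℤ) :
    volume (dyadicIco m k) = ENNReal.ofReal (1 / 2 ^ m) := by
  rw [dyadicIco, Real.volume_Ico]
  congr 1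
  ring

theorem floor_mul_two_pow {m j : ℕ} (h : m ≤ j) (x : ℝ) :
    ⌊x * 2 ^ m⌋ = ⌊x * 2 ^ j⌋ / ((2 ^ (j - m) : ℕ) : ℤ) := by
  rw [← Int.floor_div_natCast]
  congr 1
  obtain ⟨d, rfl⟩ := Nat.exists_eq_add_of_le h
  rw [Nat.add_sub_cancel_left, pow_add]
  push_cast
  field_simp

theorem dyadicIco_subset_or_disjoint {m j : ℕ} (h : m ≤ j) (k i : ℤ) :
    dyadicIco j i ⊆ dyadicIco m k ∨ Disjoint (dyadicIco j i) (dyadicIco m k) := by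
  rw [or_iff_not_imp_right, Set.not_disjoint_iff]
  rintro ⟨x, hx, hx'⟩ y hy
  rw [mem_dyadicIco] at *
  rw [floor_mul_two_pow h, hy, ← hx, ← floor_mul_two_pow h, hx']

theorem disjoint_dyadicIco {m : ℕ} {k i : ℤ} (h : i ≠ k) :
    Disjoint (dyadicIco m i) (dyadicIco m k) := by
  refine Set.disjoint_left.2 fun x hx hx' => h ?_
  rw [mem_dyadicIco] at hx hx'
  exact hx.symm.trans hx'

theorem dyadicIco_eq_union (m : ℕ) (k : ℤ) :
    dyadicIco m k = dyadicIco (m + 1) (2 * k) ∪ dyadicIco (m + 1) (2 * k + 1) := by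
  ext x
  rw [mem_union, mem_dyadicIco, mem_dyadicIco, mem_dyadicIco, floor_mul_two_pow m.le_succ]
  simp only [Nat.succ_eq_add_one, Nat.add_sub_cancel_left, pow_one, Nat.cast_ofNat]
  omega

/-- A nonnegative bounded function supported in a dyadic interval, vanishing near `F`, whose
integral over any dyadic interval of generation `j` is at most `(cj + M) / 2 ^ j`. -/
structure IsBudgeted (c M : ℝ) (F : Set ℝ) (m : ℕ) (k : ℤ) (v : ℝ → ℝ) : Prop where
  measurable : Measurable v
  nonneg : ∀ x, 0 ≤ v x
  bounded : ∃ C, ∀ x, v x ≤ C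
  eq_zero : ∀ x, x ∉ dyadicIco m k → v x = 0
  disjoint : Disjoint (tsupport v) F
  setIntegral_le : ∀ j, m ≤ j → ∀ i, ∫ x in dyadicIco j i, v x ≤ (c * j + M) / 2 ^ j

/-- The number `t` is the integral of some budgeted function. -/
def IsReachable (c M : ℝ) (F : Set ℝ) (m : ℕ) (k : ℤ) (t : ℝ) : Prop :=
  ∃ v, IsBudgeted c M F m k v ∧ ∫ x, v x = t

theorem integrable_of_bounded_of_eq_zero {v : ℝ → ℝ} (hv : Measurable v) (h0 : ∀ x, 0 ≤ v x)
    {C : ℝ} (hC : ∀ x, v x ≤ C) {s : Set ℝ} (hs : volume s ≠ ⊤)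
    (hvs : ∀ x, x ∉ s → v x = 0) : Integrable v := by
  rw [← integrableOn_iff_integrable_of_support_subset (s := s)
    (Function.support_subset_iff'.2 hvs)]
  exact Measure.integrableOn_of_bounded hs hv.aestronglyMeasurable
    (ae_of_all _ fun x => by rw [Real.norm_of_nonneg (h0 x)]; exact hC x)

section Budget

variable {c M : ℝ} {F : Set ℝ} {m : ℕ} {k : ℤ}

theorem IsBudgeted.integrable {v : ℝ → ℝ} (h : IsBudgeted c M F m k v) : Integrable v := by
  obtain ⟨C, hC⟩ := h.bounded
  exact integrable_of_bounded_of_eq_zero h.measurable h.nonneg hC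
    (by rw [volume_dyadicIco]; exact ENNReal.ofReal_ne_top) h.eq_zero

theorem isReachable_zero (hc : 0 ≤ c) (hM : 0 ≤ M) : IsReachable c M F m k 0 := by
  refine ⟨fun _ => 0, ⟨measurable_const, fun _ => le_rfl, ⟨0, fun _ => le_rfl⟩, fun _ _ => rfl,
    ?_, fun j _ i => ?_⟩, by simp⟩
  · have : tsupport (fun _ : ℝ => (0:ℝ)) = ∅ := by simp [tsupport]
    rw [this]; exact empty_disjoint _
  · rw [integral_zero]; positivity

theorem IsReachable.of_le (hc : 0 ≤ c) (hM : 0 ≤ M) {t s : ℝ} (h : IsReachable c M F m k t)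
    (hs : 0 ≤ s) (hst : s ≤ t) : IsReachable c M F m k s := by
  rcases hs.eq_or_lt with rfl | hs
  · exact isReachable_zero hc hM
  obtain ⟨v, hv, rfl⟩ := h
  have ht := hs.trans_le hst
  have hθ : 0 ≤ s / ∫ x, v x := by positivity
  have hθ1 : s / ∫ x, v x ≤ 1 := (div_le_one ht).2 hst
  refine ⟨fun x => (s / ∫ x, v x) * v x, ⟨hv.measurable.const_mul _,
    fun x => mul_nonneg hθ (hv.nonneg x), ?_, fun x hx => by rw [hv.eq_zero x hx, mul_zero],
    hv.disjoint.mono_left ?_, fun j hj i => ?_⟩, ?_⟩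
  · obtain ⟨C, hC⟩ := hv.bounded
    exact ⟨C, fun x => (mul_le_of_le_one_left (hv.nonneg x) hθ1).trans (hC x)⟩
  · exact tsupport_mul_subset_right
  · rw [integral_const_mul]
    exact (mul_le_of_le_one_left (integral_nonneg hv.nonneg) hθ1).trans
      (hv.setIntegral_le j hj i)
  · rw [integral_const_mul, div_mul_cancel₀ _ ht.ne']

theorem isReachable_of_disjoint (hc : 0 ≤ c) (hM : 0 ≤ M)
    (h : Disjoint (closure (dyadicIco m k)) F) : IsReachable c M F m k ((c * m + M) / 2 ^ m) := by
  have hvol : ∀ j i, volume.real (dyadicIco j i) = 1 / 2 ^ j := fun j i => by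
    rw [measureReal_def, volume_dyadicIco, ENNReal.toReal_ofReal (by positivity)]
  refine ⟨(dyadicIco m k).indicator fun _ => c * m + M, ⟨measurable_const.indicator
    (measurableSet_dyadicIco _ _), fun x => indicator_nonneg (fun _ _ => by positivity) x,
    ⟨c * m + M, fun x => indicator_le_self' (fun _ _ => by positivity) x⟩,
    fun x hx => indicator_of_notMem hx _, h.mono_left (closure_mono support_indicator_subset),
    fun j hj i => ?_⟩, ?_⟩
  · refine (setIntegral_mono_on (g := fun _ => c * j + M) ?_ ?_
      (measurableSet_dyadicIco _ _) fun x _ => ?_).trans ?_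
    · refine ((integrable_indicator_iff (measurableSet_dyadicIco _ _)).2 ?_).integrableOn
      exact integrableOn_const (by rw [volume_dyadicIco]; exact ENNReal.ofReal_ne_top)
    · exact integrableOn_const (by rw [volume_dyadicIco]; exact ENNReal.ofReal_ne_top)
    · refine (indicator_le_self' (fun _ _ => by positivity) x).trans ?_
      have : (m : ℝ) ≤ j := by exact_mod_cast hj
      nlinarith
    · rw [setIntegral_const, hvol, smul_eq_mul, one_div_mul_eq_div]
  · rw [integral_indicator (measurableSet_dyadicIco _ _), setIntegral_const, hvol, smul_eq_mul,
      one_div_mul_eq_div]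

theorem IsReachable.add {s t : ℝ}
    (hs : IsReachable c M F (m + 1) (2 * k) s) (ht : IsReachable c M F (m + 1) (2 * k + 1) t)
    (hst : s + t ≤ (c * m + M) / 2 ^ m) : IsReachable c M F m k (s + t) := by
  obtain ⟨v, hv, rfl⟩ := hs
  obtain ⟨w, hw, rfl⟩ := ht
  have h0 : ∀ x, x ∉ dyadicIco m k → v x + w x = 0 := fun x hx => by
    rw [dyadicIco_eq_union, mem_union, not_or] at hx
    rw [hv.eq_zero x hx.1, hw.eq_zero x hx.2, add_zero]
  refine ⟨fun x => v x + w x, ⟨hv.measurable.add hw.measurable,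
    fun x => add_nonneg (hv.nonneg x) (hw.nonneg x), ?_, h0, ?_, fun j hj i => ?_⟩,
    integral_add hv.integrable hw.integrable⟩
  · obtain ⟨C, hC⟩ := hv.bounded
    obtain ⟨D, hD⟩ := hw.bounded
    exact ⟨C + D, fun x => add_le_add (hC x) (hD x)⟩
  · refine (hv.disjoint.union_left hw.disjoint).mono_left ?_
    rw [tsupport, tsupport, tsupport, ← closure_union]
    exact closure_mono (Function.support_add _ _)
  · rcases hj.eq_or_lt with rfl | hj
    · rw [← integral_add hv.integrable hw.integrable] at hst
      exact (setIntegral_le_integral (hv.integrable.add hw.integrable)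
        (ae_of_all _ fun x => add_nonneg (hv.nonneg x) (hw.nonneg x))).trans hst
    · have hd : Disjoint (dyadicIco (m + 1) (2 * k)) (dyadicIco (m + 1) (2 * k + 1)) :=
        disjoint_dyadicIco (by omega)
      rcases dyadicIco_subset_or_disjoint hj (2 * k) i with h | h
      · rw [setIntegral_congr_fun (g := v) (measurableSet_dyadicIco _ _) fun x hx => by
          simp only [hw.eq_zero x (Set.disjoint_left.1 hd (h hx)), add_zero]]
        exact hv.setIntegral_le j hj i
      · rw [setIntegral_congr_fun (g := w) (measurableSet_dyadicIco _ _) fun x hx => by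
          simp only [hv.eq_zero x (Set.disjoint_left.1 h hx), zero_add]]
        exact hw.setIntegral_le j hj i

end Budget

/-- A dyadic interval is saturated if its full budget is reachable. -/
def IsSaturated (c M : ℝ) (F : Set ℝ) (m : ℕ) (k : ℤ) : Prop :=
  IsReachable c M F m k ((c * m + M) / 2 ^ m)

open Classical in
/-- The density `c τ + M`, where `τ` is the generation of the largest saturated dyadic interval
containing `x` among those of generations `m, …, m + d`, and `0` if there is none. -/
def stoppedBudget (c M : ℝ) (F : Set ℝ) : ℕ → ℕ → ℝ → ℝ
  | 0, m, x => if IsSaturated c M F m ⌊x * 2 ^ m⌋ then c * m + M else 0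
  | d + 1, m, x => if IsSaturated c M F m ⌊x * 2 ^ m⌋ then c * m + M
      else stoppedBudget c M F d (m + 1) x

section StoppedBudget

variable {c M : ℝ} {F : Set ℝ}

theorem measurableSet_isSaturated (m : ℕ) :
    MeasurableSet {x : ℝ | IsSaturated c M F m ⌊x * 2 ^ m⌋} :=
  (by fun_prop : Measurable fun x : ℝ => ⌊x * 2 ^ m⌋) (MeasurableSet.of_discrete
    (s := {k | IsSaturated c M F m k}))

theorem measurable_stoppedBudget (d m : ℕ) : Measurable (stoppedBudget c M F d m) := by
  classical
  induction d generalizing m with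
  | zero => exact Measurable.ite (measurableSet_isSaturated m) measurable_const measurable_const
  | succ d ih => exact Measurable.ite (measurableSet_isSaturated m) measurable_const (ih _)

theorem stoppedBudget_nonneg (hc : 0 ≤ c) (hM : 0 ≤ M) (d m : ℕ) (x : ℝ) :
    0 ≤ stoppedBudget c M F d m x := by
  induction d generalizing m with
  | zero => rw [stoppedBudget]; split_ifs <;> positivity
  | succ d ih => rw [stoppedBudget]; split_ifs; exacts [by positivity, ih _]

theorem stoppedBudget_le (hc : 0 ≤ c) (hM : 0 ≤ M) (d m : ℕ) (x : ℝ) :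
    stoppedBudget c M F d m x ≤ c * (m + d : ℕ) + M := by
  induction d generalizing m with
  | zero => rw [stoppedBudget]; split_ifs; exacts [by simp, by positivity]
  | succ d ih =>
    rw [stoppedBudget]
    split_ifs
    · push_cast; nlinarith [(by positivity : (0:ℝ) ≤ d)]
    · refine (ih _).trans (le_of_eq ?_); push_cast; ring

theorem stoppedBudget_mono (hc : 0 ≤ c) (hM : 0 ≤ M) (m : ℕ) (x : ℝ) :
    Monotone fun d => stoppedBudget c M F d m x := by
  refine monotone_nat_of_le_succ fun d => ?_
  induction d generalizing m with
  | zero =>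
    rw [stoppedBudget, stoppedBudget]
    split_ifs
    exacts [le_rfl, stoppedBudget_nonneg hc hM _ _ _]
  | succ d ih =>
    by_cases h : IsSaturated c M F m ⌊x * 2 ^ m⌋
    · simp only [stoppedBudget, if_pos h, le_refl]
    · rw [stoppedBudget, if_neg h]
      conv_rhs => rw [stoppedBudget, if_neg h]
      exact ih _

theorem exists_stoppedBudget_eq {d m : ℕ} {x : ℝ}
    (h : IsSaturated c M F (m + d) ⌊x * 2 ^ (m + d)⌋) :
    ∃ τ, m ≤ τ ∧ IsSaturated c M F τ ⌊x * 2 ^ τ⌋ ∧ stoppedBudget c M F d m x = c * τ + M := by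
  induction d generalizing m with
  | zero => exact ⟨m, le_rfl, h, if_pos h⟩
  | succ d ih =>
    by_cases hm : IsSaturated c M F m ⌊x * 2 ^ m⌋
    · exact ⟨m, le_rfl, hm, by rw [stoppedBudget, if_pos hm]⟩
    · obtain ⟨τ, hτ, hs, e⟩ := ih (m := m + 1) (by rwa [add_right_comm, add_assoc])
      exact ⟨τ, by omega, hs, by rw [stoppedBudget, if_neg hm, e]⟩

theorem isReachable_setIntegral_stoppedBudget (hc : 0 ≤ c) (hM : 0 ≤ M) (d m : ℕ) (k : ℤ) :
    IsReachable c M F m k (∫ x in dyadicIco m k, stoppedBudget c M F d m x) := by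
  have h_int : ∀ d m j i, IntegrableOn (stoppedBudget c M F d m) (dyadicIco j i) :=
    fun d m j i => Measure.integrableOn_of_bounded
      (by rw [volume_dyadicIco]; exact ENNReal.ofReal_ne_top)
      (measurable_stoppedBudget d m).aestronglyMeasurable (ae_of_all _ fun x => by
        rw [Real.norm_of_nonneg (stoppedBudget_nonneg hc hM _ _ _)]
        exact stoppedBudget_le hc hM d m x)
  have hsat : ∀ d m k, IsSaturated c M F m k →
      IsReachable c M F m k (∫ x in dyadicIco m k, stoppedBudget c M F d m x) := by
    intro d m k h
    have : ∫ x in dyadicIco m k, stoppedBudget c M F d m x = (c * m + M) / 2 ^ m := by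
      rw [setIntegral_congr_fun (g := fun _ => c * m + M) (measurableSet_dyadicIco _ _)
        fun x hx => ?_]
      · rw [setIntegral_const, measureReal_def, volume_dyadicIco,
          ENNReal.toReal_ofReal (by positivity), smul_eq_mul, one_div_mul_eq_div]
      · rw [← mem_dyadicIco.1 hx] at h
        cases d <;> simp only [stoppedBudget, if_pos h]
    rw [this]; exact h
  induction d generalizing m k with
  | zero =>
    by_cases h : IsSaturated c M F m k
    · exact hsat _ _ _ h
    · rw [setIntegral_congr_fun (g := fun _ => 0) (measurableSet_dyadicIco _ _) fun x hx => ?_]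
      · rw [integral_zero]; exact isReachable_zero hc hM
      · rw [← mem_dyadicIco.1 hx] at h
        rw [stoppedBudget, if_neg h]
  | succ d ih =>
    by_cases h : IsSaturated c M F m k
    · exact hsat _ _ _ h
    · rw [setIntegral_congr_fun (g := stoppedBudget c M F d (m + 1))
        (measurableSet_dyadicIco _ _) fun x hx => ?_]
      · rw [dyadicIco_eq_union, setIntegral_union (disjoint_dyadicIco (by omega))
          (measurableSet_dyadicIco _ _) (h_int _ _ _ _) (h_int _ _ _ _)]
        have h1 := ih (m + 1) (2 * k)
        have h2 := ih (m + 1) (2 * k + 1)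
        have p1 := setIntegral_nonneg (μ := volume) (measurableSet_dyadicIco (m + 1) (2 * k))
          fun x _ => stoppedBudget_nonneg (F := F) hc hM d (m + 1) x
        have p2 := setIntegral_nonneg (μ := volume) (measurableSet_dyadicIco (m + 1) (2 * k + 1))
          fun x _ => stoppedBudget_nonneg (F := F) hc hM d (m + 1) x
        generalize (∫ x in dyadicIco (m + 1) (2 * k), stoppedBudget c M F d (m + 1) x) = s at *
        generalize (∫ x in dyadicIco (m + 1) (2 * k + 1), stoppedBudget c M F d (m + 1) x) = t
          at *
        refine h1.add h2 ?_
        by_contra! hlt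
        refine h ?_
        have hB : 0 ≤ (c * m + M) / 2 ^ m := by positivity
        set B := (c * m + M) / 2 ^ m with hBdef
        have hst : 0 < s + t := hB.trans_lt hlt
        have hθ : B / (s + t) ≤ 1 := (div_le_one hst).2 hlt.le
        have hθ0 : 0 ≤ B / (s + t) := by positivity
        have e : B / (s + t) * s + B / (s + t) * t = B := by field_simp
        have := (h1.of_le hc hM (mul_nonneg hθ0 p1) (mul_le_of_le_one_left p1 hθ)).add
          (h2.of_le hc hM (mul_nonneg hθ0 p2) (mul_le_of_le_one_left p2 hθ))
          (by rw [e])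
        rwa [e] at this
      · rw [← mem_dyadicIco.1 hx] at h
        rw [stoppedBudget, if_neg h]

end StoppedBudget

theorem isSaturated_of_notMem {c M : ℝ} {F : Set ℝ} (hc : 0 ≤ c) (hM : 0 ≤ M) (hF : IsClosed F)
    {x : ℝ} (hx : x ∉ F) (n : ℕ) : ∃ m ≥ n, IsSaturated c M F m ⌊x * 2 ^ m⌋ := by
  obtain ⟨ε, hε, hεF⟩ := Metric.mem_nhds_iff.1 (hF.isOpen_compl.mem_nhds hx)
  obtain ⟨m, hm⟩ := exists_pow_lt_of_lt_one hε (by norm_num : (1 / 2 : ℝ) < 1)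
  have hm' : (1 / 2 : ℝ) ^ max m n < ε :=
    (pow_le_pow_of_le_one (by norm_num) (by norm_num) (le_max_left m n)).trans_lt hm
  set j := max m n
  refine ⟨j, le_max_right _ _, isReachable_of_disjoint hc hM ?_⟩
  refine (disjoint_compl_left (a := F)).mono_left (Subset.trans ?_ hεF)
  have hxj : x ∈ dyadicIco j ⌊x * 2 ^ j⌋ := mem_dyadicIco.2 rfl
  rw [dyadicIco] at hxj ⊢
  rw [closure_Ico (by rw [Ne, div_left_inj' (by positivity)]; simp)]
  have h2 : ((⌊x * 2 ^ j⌋ + 1) / 2 ^ j : ℝ) = ⌊x * 2 ^ j⌋ / 2 ^ j + (1 / 2) ^ j := by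
    rw [one_div_pow]; ring
  intro y hy
  rw [h2] at hy hxj
  rw [mem_ball, Real.dist_eq, abs_lt]
  constructor <;> linarith [hy.1, hy.2, hxj.1, hxj.2]

theorem exists_satisfiesCarleson {c M : ℝ} {F : Set ℝ} {n : ℕ} {k : ℤ} (hc : 0 < c) (hM : 0 < M)
    (hn : 1 ≤ n) (hF : IsClosed F) (h : ¬ IsReachable c M F n k (M / 2 ^ n)) :
    ∃ E ⊆ F, IsCompact E ∧ arcMeasure (circlePoint '' E) ≠ 0 ∧
      SatisfiesCarleson (circlePoint '' E) := by
  set J : Set ℝ := dyadicIco n k with hJ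
  set l : ℝ := k / 2 ^ n with hl
  set r : ℝ := (k + 1) / 2 ^ n with hr
  have hJI : J = Ico l r := rfl
  have hJvol : volume J = ENNReal.ofReal (1 / 2 ^ n) := volume_dyadicIco _ _
  have h2n : (2:ℝ) ≤ 2 ^ n := by
    calc (2:ℝ) = 2 ^ 1 := by norm_num
      _ ≤ 2 ^ n := pow_le_pow_right₀ (by norm_num) hn
  have hlr : r = l + 1 / 2 ^ n := by rw [hl, hr]; ring
  have hpos : (0:ℝ) < 1 / 2 ^ n := by positivity
  have hhalf : (1:ℝ) / 2 ^ n ≤ 1 / 2 := one_div_le_one_div_of_le (by norm_num) h2n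
  set Ψ : ℝ → ENNReal := fun x => ⨆ d, ENNReal.ofReal (stoppedBudget c M F d n x) with hΨ
  have hΨJ : ∫⁻ x in J, Ψ x ≤ ENNReal.ofReal (M / 2 ^ n) := by
    rw [hΨ, lintegral_iSup (fun d => (measurable_stoppedBudget d n).ennreal_ofReal)
      fun d e hde x => ENNReal.ofReal_le_ofReal (stoppedBudget_mono hc.le hM.le n x hde)]
    refine iSup_le fun d => ?_
    rw [← ofReal_integral_eq_lintegral_ofReal]
    · refine ENNReal.ofReal_le_ofReal ?_
      by_contra! hlt
      exact h ((isReachable_setIntegral_stoppedBudget hc.le hM.le d n k).of_le hc.le hM.le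
        (by positivity) hlt.le)
    · exact Measure.integrableOn_of_bounded
        (by rw [hJvol]; exact ENNReal.ofReal_ne_top)
        (measurable_stoppedBudget d n).aestronglyMeasurable (ae_of_all _ fun x => by
          rw [Real.norm_of_nonneg (stoppedBudget_nonneg hc.le hM.le _ _ _)]
          exact stoppedBudget_le hc.le hM.le d n x)
    · exact ae_of_all _ fun x => stoppedBudget_nonneg hc.le hM.le _ _ _
  set A : Set ℝ := {x | ∃ m ≥ n, IsSaturated c M F m ⌊x * 2 ^ m⌋} with hA
  have hAm : MeasurableSet A := by
    have : A = ⋃ m, ⋃ (_ : m ≥ n), {x : ℝ | IsSaturated c M F m ⌊x * 2 ^ m⌋} := by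
      ext x; simp [hA]
    rw [this]
    exact MeasurableSet.iUnion fun m => MeasurableSet.iUnion fun _ => measurableSet_isSaturated m
  have hAΨ : ∀ x ∈ A, ∃ τ ≥ n, IsSaturated c M F τ ⌊x * 2 ^ τ⌋ ∧
      ENNReal.ofReal (c * τ + M) ≤ Ψ x := by
    rintro x ⟨m, hm, hx⟩
    obtain ⟨d, rfl⟩ := Nat.exists_eq_add_of_le hm
    obtain ⟨τ, hτ, hs, e⟩ := exists_stoppedBudget_eq hx
    exact ⟨τ, hτ, hs, by rw [← e]; exact le_iSup (fun d => ENNReal.ofReal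
      (stoppedBudget c M F d n x)) d⟩
  have hJA : volume (J \ A) ≠ 0 := by
    intro h0
    have h1 : volume (J ∩ A) = ENNReal.ofReal (1 / 2 ^ n) := by
      rw [← hJvol, ← measure_inter_add_sdiff J hAm, h0, add_zero]
    have h2 : ENNReal.ofReal (c * n + M) * volume (J ∩ A) ≤ ENNReal.ofReal (M / 2 ^ n) := by
      rw [← setLIntegral_const]
      refine le_trans ?_ ((lintegral_mono_set (inter_subset_left (t := A))).trans hΨJ)
      refine setLIntegral_mono' ((measurableSet_dyadicIco _ _).inter hAm) fun x hx => ?_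
      obtain ⟨τ, hτ, -, hΨτ⟩ := hAΨ x hx.2
      refine le_trans (ENNReal.ofReal_le_ofReal ?_) hΨτ
      have : (n:ℝ) ≤ τ := by exact_mod_cast hτ
      nlinarith
    rw [h1, ← ENNReal.ofReal_mul (by positivity), ENNReal.ofReal_le_ofReal_iff (by positivity),
      mul_one_div, div_le_div_iff_of_pos_right (by positivity)] at h2
    have : (1:ℝ) ≤ n := by exact_mod_cast hn
    nlinarith
  set O : Set ℝ := ⋃ m, ⋃ (_ : m ≥ n), ⋃ j : ℤ, ⋃ (_ : IsSaturated c M F m j),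
    Ioo (j / 2 ^ m : ℝ) ((j + 1) / 2 ^ m) with hO
  have hOo : IsOpen O := isOpen_iUnion fun _ => isOpen_iUnion fun _ => isOpen_iUnion fun _ =>
    isOpen_iUnion fun _ => isOpen_Ioo
  have hOA : O ⊆ A := by
    intro x hx
    simp only [hO, mem_iUnion] at hx
    obtain ⟨m, hm, j, hj, hx⟩ := hx
    refine ⟨m, hm, ?_⟩
    rwa [mem_dyadicIco.1 (Ioo_subset_Ico_self hx : x ∈ dyadicIco m j)]
  set E : Set ℝ := (Icc l r ∩ F) \ O with hE
  have hEc : IsCompact E := (isCompact_Icc.inter_right hF).diff hOo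
  have hJAE : J \ A ⊆ E := by
    refine fun x hx => ⟨⟨Ico_subset_Icc_self hx.1, ?_⟩, fun h => hx.2 (hOA h)⟩
    by_contra hxF
    exact hx.2 (isSaturated_of_notMem hc.le hM.le hF hxF n)
  have hEvol : volume E ≠ 0 := fun h0 => hJA (measure_mono_null hJAE h0)
  have hEne : E.Nonempty := nonempty_of_measure_ne_zero hEvol
  set a := sInf E with ha
  have haE : a ∈ E := hEc.sInf_mem hEne
  have hla : l ≤ a := haE.1.1.1
  have hEa : E ⊆ Ico a (a + 1) := fun x hx =>
    ⟨csInf_le hEc.bddBelow hx, by linarith [hx.1.1.2]⟩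
  refine ⟨E, fun x hx => hx.1.2, hEc, ?_, ?_⟩
  · rw [arcMeasure_image_circlePoint hEc.measurableSet hEa]
    exact mul_ne_zero (by simp [Real.pi_pos]) hEvol
  set U := Ioo a (a + 1) \ E with hU
  have hUfin : volume U ≠ ⊤ := ((measure_mono sdiff_subset).trans_lt measure_Ioo_lt_top).ne
  have hcompfin : ∀ x, volume (connectedComponentIn U x) ≠ ⊤ := fun x =>
    ((measure_mono (connectedComponentIn_subset _ _)).trans_lt hUfin.lt_top).ne
  have hlog : ∀ (m : ℕ) (s t x : ℝ), t = s + 1 / 2 ^ m → x ∈ Ioo s t → Ioo s t ⊆ U →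
      -Real.log (volume (connectedComponentIn U x)).toReal ≤ m * Real.log 2 := by
    intro m s t x hst hx hsU
    have h1 : Ioo s t ⊆ connectedComponentIn U x :=
      isPreconnected_Ioo.subset_connectedComponentIn hx hsU
    have h2 : (1:ℝ) / 2 ^ m ≤ (volume (connectedComponentIn U x)).toReal := by
      have := ENNReal.toReal_mono (hcompfin x) (measure_mono (μ := volume) h1)
      rwa [Real.volume_Ioo, hst, add_sub_cancel_left, ENNReal.toReal_ofReal (by positivity)]
        at this
    have h3 := Real.log_le_log (by positivity) h2
    rw [one_div, Real.log_inv, Real.log_pow] at h3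
    linarith
  have hlog2 : 0 ≤ Real.log 2 := Real.log_nonneg (by norm_num)
  refine satisfiesCarleson_image_circlePoint (G := fun x => ENNReal.ofReal (Real.log 2) +
    ENNReal.ofReal (Real.log 2 / c) * J.indicator Ψ x) hEc.isClosed haE hEa ?_ ?_
  · have hΨm : Measurable Ψ :=
      Measurable.iSup fun d => (measurable_stoppedBudget d n).ennreal_ofReal
    rw [lintegral_add_left measurable_const, lintegral_const_mul _
      (hΨm.indicator (measurableSet_dyadicIco _ _)), setLIntegral_const]
    refine ENNReal.add_ne_top.2 ⟨ENNReal.mul_ne_top ENNReal.ofReal_ne_top hUfin,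
      ENNReal.mul_ne_top ENNReal.ofReal_ne_top ?_⟩
    refine ((setLIntegral_le_lintegral _ _).trans_lt ?_).ne
    rw [lintegral_indicator (measurableSet_dyadicIco _ _)]
    exact hΨJ.trans_lt ENNReal.ofReal_lt_top
  · have hD : (⋃ m : ℕ, range fun j : ℤ => (j / 2 ^ m : ℝ)).Countable :=
      countable_iUnion fun m => countable_range _
    filter_upwards [hD.ae_notMem volume] with x hxD hxU
    rcases lt_or_ge x r with hxr | hxr
    · have hxJ : x ∈ J := ⟨hla.trans hxU.1.1.le, hxr⟩
      have hxA : x ∈ A := by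
        by_contra hxA
        exact hxU.2 (hJAE ⟨hxJ, hxA⟩)
      obtain ⟨τ, hτ, hs, hΨτ⟩ := hAΨ x hxA
      set j := ⌊x * 2 ^ τ⌋ with hj
      have hxj : x ∈ dyadicIco τ j := mem_dyadicIco.2 rfl
      have hjJ : dyadicIco τ j ⊆ J := (dyadicIco_subset_or_disjoint hτ k j).resolve_right
        (Set.not_disjoint_iff.2 ⟨x, hxj, hxJ⟩)
      have hxj' : x ∈ Ioo (j / 2 ^ τ : ℝ) ((j + 1) / 2 ^ τ) := by
        refine ⟨lt_of_le_of_ne hxj.1 fun h => hxD ?_, hxj.2⟩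
        exact mem_iUnion.2 ⟨τ, j, h⟩
      have hjO : Ioo (j / 2 ^ τ : ℝ) ((j + 1) / 2 ^ τ) ⊆ O := by
        intro y hy
        simp only [hO, mem_iUnion]
        exact ⟨τ, hτ, j, hs, hy⟩
      have hjU : Ioo (j / 2 ^ τ : ℝ) ((j + 1) / 2 ^ τ) ⊆ U := by
        intro y hy
        refine ⟨⟨?_, ?_⟩, fun hyE => hyE.2 (hjO hy)⟩
        · by_contra! hya
          exact haE.2 (hjO ⟨hy.1.trans_le hya, hxU.1.1.trans hxj'.2⟩)
        · have := (hjJ (Ioo_subset_Ico_self hy)).2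
          linarith
      have h1 := hlog τ _ _ x (by ring) hxj' hjU
      rw [indicator_of_mem hxJ]
      refine le_add_left ?_
      calc ENNReal.ofReal (-Real.log (volume (connectedComponentIn U x)).toReal)
          ≤ ENNReal.ofReal (Real.log 2 / c * (c * τ + M)) := by
            refine ENNReal.ofReal_le_ofReal (h1.trans ?_)
            have : Real.log 2 / c * (c * τ + M) = τ * Real.log 2 + Real.log 2 / c * M := by
              field_simp
            rw [this]
            have : 0 ≤ Real.log 2 / c * M := by positivity
            linarith
        _ ≤ _ := by
            rw [ENNReal.ofReal_mul (by positivity)]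
            gcongr
    · refine le_add_right (ENNReal.ofReal_le_ofReal ?_)
      have hra : r ≤ a + 1 / 2 := by linarith
      have h1 : Ioo r (a + 1) ⊆ U := fun y hy =>
        ⟨⟨by linarith [hy.1, haE.1.1.2], hy.2⟩, fun hyE => not_lt.2 hyE.1.1.2 hy.1⟩
      have h2 : Ico x (a + 1) ⊆ U := by
        intro y hy
        rcases hy.1.eq_or_lt with rfl | hxy
        · exact hxU
        · exact h1 ⟨hxr.trans_lt hxy, hy.2⟩
      have h3 : Ioo r (a + 1) ⊆ connectedComponentIn U x := by
        have hpre : IsPreconnected (Ioo r (a + 1) ∪ Ico x (a + 1)) := by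
          refine IsPreconnected.union ((x + (a + 1)) / 2) ⟨?_, ?_⟩ ⟨?_, ?_⟩ isPreconnected_Ioo
            isPreconnected_Ico <;> linarith [hxU.1.2]
        exact subset_union_left.trans (hpre.subset_connectedComponentIn
          (Or.inr ⟨le_rfl, hxU.1.2⟩) (union_subset h1 h2))
      have h4 : (1:ℝ) / 2 ≤ (volume (connectedComponentIn U x)).toReal := by
        have := ENNReal.toReal_mono (hcompfin x) (measure_mono (μ := volume) h3)
        rw [Real.volume_Ioo, ENNReal.toReal_ofReal (by linarith)] at this
        linarith
      have h5 := Real.log_le_log (by positivity) h4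
      rw [one_div, Real.log_inv] at h5
      linarith

theorem BergmanAdmissible.not_satisfiesCarleson {K E : Set ℂ} (hK : BergmanAdmissible K)
    (hEK : E ⊆ K) (hE : IsCompact E) (hE0 : arcMeasure E ≠ 0) : ¬ SatisfiesCarleson E := by
  rcases hK with h | h
  · exact h.2 E hEK hE hE0
  · refine absurd (measure_mono_null ?_ h) hE0
    exact fun θ hθ => ⟨hθ.1, hEK hθ.2⟩

theorem Ico_eq_biUnion_dyadicIco (m : ℕ) :
    Ico (0:ℝ) 1 = ⋃ k ∈ Finset.range (2 ^ m), dyadicIco m (k : ℤ) := by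
  ext x
  have h2 : (0:ℝ) < 2 ^ m := by positivity
  simp only [mem_iUnion, mem_dyadicIco, Finset.mem_range, exists_prop, mem_Ico]
  constructor
  · rintro ⟨h0, h1⟩
    have h3 : 0 ≤ ⌊x * 2 ^ m⌋ := Int.floor_nonneg.2 (by positivity)
    have h4 : ⌊x * 2 ^ m⌋ < (2 ^ m : ℕ) := by
      rw [Int.floor_lt]; push_cast; nlinarith
    exact ⟨⌊x * 2 ^ m⌋.toNat, by omega, by omega⟩
  · rintro ⟨k, hk, h⟩
    rw [Int.floor_eq_iff] at h
    have h5 : (k:ℝ) + 1 ≤ 2 ^ m := by exact_mod_cast hk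
    push_cast at h
    constructor
    · by_contra! hx
      have : (0:ℝ) ≤ k := by positivity
      nlinarith
    · by_contra! hx
      nlinarith

theorem dyadicIco_subset_Ico {m k : ℕ} (hk : k < 2 ^ m) : dyadicIco m (k : ℤ) ⊆ Ico 0 1 := by
  rw [Ico_eq_biUnion_dyadicIco m]
  exact subset_biUnion_of_mem (u := fun k : ℕ => dyadicIco m (k : ℤ)) (Finset.mem_range.2 hk)

theorem setIntegral_Ico_eq_sum_dyadicIco {E : Type*} [NormedAddCommGroup E] [NormedSpace ℝ E]
    (m : ℕ) {f : ℝ → E} (hf : IntegrableOn f (Ico 0 1)) :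
    ∫ x in Ico 0 1, f x = ∑ k ∈ Finset.range (2 ^ m), ∫ x in dyadicIco m (k : ℤ), f x := by
  have h := hf
  rw [Ico_eq_biUnion_dyadicIco m] at h
  rw [Ico_eq_biUnion_dyadicIco m]
  refine integral_biUnion_finset _ (fun k _ => measurableSet_dyadicIco _ _)
    (fun j _ k _ hjk => disjoint_dyadicIco (by exact_mod_cast hjk)) fun k hk => ?_
  exact h.mono_set (subset_biUnion_of_mem (u := fun k : ℕ => dyadicIco m (k : ℤ)) hk)

/-- A nonnegative bounded function on `[0, 1)` vanishing near `F`, with all integrals over dyadic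
intervals of generation `n` equal to `M / 2 ^ n`, and with integrals over dyadic intervals of
generation `j ≥ n` at most `(cj + M) / 2 ^ j`. -/
structure IsBalancedDensity (c M : ℝ) (F : Set ℝ) (n : ℕ) (v : ℝ → ℝ) : Prop where
  measurable : Measurable v
  nonneg : ∀ x, 0 ≤ v x
  bounded : ∃ C, ∀ x, v x ≤ C
  eq_zero : ∀ x, x ∉ Ico (0:ℝ) 1 → v x = 0
  disjoint : Disjoint (tsupport v) F
  setIntegral_le : ∀ j, n ≤ j → ∀ i : ℕ, ∫ x in dyadicIco j i, v x ≤ (c * j + M) / 2 ^ j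
  setIntegral_eq : ∀ i : ℕ, i < 2 ^ n → ∫ x in dyadicIco n i, v x = M / 2 ^ n

theorem exists_isBalancedDensity {c M : ℝ} {K : Set ℂ} {n : ℕ} (hc : 0 < c) (hM : 0 < M)
    (hn : 1 ≤ n) (hKc : IsCompact K) (hK : BergmanAdmissible K) :
    ∃ v, IsBalancedDensity c M (circlePoint ⁻¹' K) n v := by
  have hr : ∀ k : ℕ, IsReachable c M (circlePoint ⁻¹' K) n k (M / 2 ^ n) := by
    intro k
    by_contra h
    obtain ⟨E, hE, hEc, hE0, hEC⟩ := exists_satisfiesCarleson hc hM hn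
      (hKc.isClosed.preimage continuous_circlePoint) h
    exact hK.not_satisfiesCarleson (image_subset_iff.2 hE) (hEc.image continuous_circlePoint)
      hE0 hEC
  choose w hw hwi using hr
  set s := Finset.range (2 ^ n)
  have hd : ∀ {i k : ℕ}, i ≠ k → ∀ x ∈ dyadicIco n (i : ℤ), w k x = 0 := fun {i k} hik x hx =>
    (hw k).eq_zero x (Set.disjoint_left.1 (disjoint_dyadicIco (by exact_mod_cast hik)) hx)
  have hsum : ∀ {i : ℕ}, i < 2 ^ n → ∀ x ∈ dyadicIco n (i : ℤ), ∑ k ∈ s, w k x = w i x :=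
    fun {i} hi x hx => Finset.sum_eq_single_of_mem i (Finset.mem_range.2 hi)
      fun k _ hk => hd hk.symm x hx
  have h0 : ∀ x, x ∉ Ico (0:ℝ) 1 → ∑ k ∈ s, w k x = 0 := fun x hx =>
    Finset.sum_eq_zero fun k hk => (hw k).eq_zero x fun h =>
      hx (dyadicIco_subset_Ico (Finset.mem_range.1 hk) h)
  refine ⟨fun x => ∑ k ∈ s, w k x, Finset.measurable_sum _ fun k _ => (hw k).measurable,
    fun x => Finset.sum_nonneg fun k _ => (hw k).nonneg x, ?_, h0, ?_, fun j hj i => ?_,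
    fun i hi => ?_⟩
  · choose C hC using fun k => (hw k).bounded
    exact ⟨∑ k ∈ s, C k, fun x => Finset.sum_le_sum fun k _ => hC k x⟩
  · have h1 : tsupport (fun x => ∑ k ∈ s, w k x) ⊆ ⋃ k ∈ s, tsupport (w k) := by
      refine closure_minimal (fun x hx => ?_)
        (s.finite_toSet.isClosed_biUnion fun k _ => isClosed_tsupport _)
      obtain ⟨k, hk, hx⟩ := Finset.exists_ne_zero_of_sum_ne_zero hx
      exact mem_biUnion hk (subset_tsupport _ hx)
    refine Disjoint.mono_left h1 ?_
    simp only [disjoint_iUnion_left]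
    exact fun k _ => (hw k).disjoint
  · by_cases h : ∃ k : ℕ, k < 2 ^ n ∧ ¬ Disjoint (dyadicIco j i) (dyadicIco n (k : ℤ))
    · obtain ⟨k, hk, h⟩ := h
      have hsub := (dyadicIco_subset_or_disjoint hj k i).resolve_right h
      rw [setIntegral_congr_fun (measurableSet_dyadicIco _ _) fun x hx => hsum hk x (hsub hx)]
      exact (hw k).setIntegral_le j hj i
    · push Not at h
      rw [setIntegral_congr_fun (g := fun _ => 0) (measurableSet_dyadicIco _ _) fun x hx =>
        Finset.sum_eq_zero fun k hk => (hw k).eq_zero x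
          (Set.disjoint_left.1 (h _ (Finset.mem_range.1 hk)) hx), integral_zero]
      positivity
  · rw [setIntegral_congr_fun (measurableSet_dyadicIco _ _) (hsum hi),
      setIntegral_eq_integral_of_forall_compl_eq_zero fun x hx => (hw i).eq_zero x hx, hwi]

theorem IsBalancedDensity.integrable {c M : ℝ} {F : Set ℝ} {n : ℕ} {v : ℝ → ℝ}
    (h : IsBalancedDensity c M F n v) : Integrable v := by
  obtain ⟨C, hC⟩ := h.bounded
  exact integrable_of_bounded_of_eq_zero h.measurable h.nonneg hC
    measure_Ico_lt_top.ne h.eq_zero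

theorem norm_circlePoint_sub_circlePoint_le (x y : ℝ) :
    ‖circlePoint x - circlePoint y‖ ≤ 2 * Real.pi * |x - y| := by
  have h : circlePoint x - circlePoint y
      = circlePoint y * (Complex.exp (I * ((2 * Real.pi * (x - y) : ℝ) : ℂ)) - 1) := by
    rw [mul_sub, mul_one, circlePoint, circlePoint, ← Complex.exp_add]
    congr 2
    push_cast
    ring
  rw [h, norm_mul, norm_circlePoint, one_mul]
  refine Real.norm_exp_I_mul_ofReal_sub_one_le.trans (le_of_eq ?_)
  rw [Real.norm_eq_abs, abs_mul, abs_of_pos (by positivity)]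

theorem one_sub_norm_le (x : ℝ) (z : ℂ) : 1 - ‖z‖ ≤ ‖circlePoint x - z‖ := by
  have := norm_sub_norm_le (circlePoint x) z
  rwa [norm_circlePoint] at this

theorem circlePoint_sub_ne_zero {z : ℂ} (hz : ‖z‖ < 1) (x : ℝ) : circlePoint x - z ≠ 0 := by
  rw [← norm_pos_iff]
  linarith [one_sub_norm_le x z]

/-- The Schwarz kernel of the unit disk, whose real part is the Poisson kernel. -/
def schwarzKernel (x : ℝ) (z : ℂ) : ℂ := (circlePoint x + z) / (circlePoint x - z)

theorem re_schwarzKernel (x : ℝ) (z : ℂ) :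
    (schwarzKernel x z).re = (1 - ‖z‖ ^ 2) / ‖circlePoint x - z‖ ^ 2 := by
  have h : ‖circlePoint x‖ ^ 2 = 1 := by rw [norm_circlePoint, one_pow]
  rw [schwarzKernel, div_re, ← h, Complex.sq_norm, Complex.sq_norm, Complex.sq_norm, ← add_div]
  congr 1
  simp only [normSq_apply, add_re, add_im, sub_re, sub_im]
  ring

theorem re_schwarzKernel_nonneg {z : ℂ} (hz : ‖z‖ < 1) (x : ℝ) : 0 ≤ (schwarzKernel x z).re := by
  rw [re_schwarzKernel]
  have : ‖z‖ ^ 2 ≤ 1 := by nlinarith [norm_nonneg z]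
  exact div_nonneg (by linarith) (by positivity)

theorem norm_schwarzKernel_sub_le {z : ℂ} (hz : ‖z‖ < 1) (x y : ℝ) :
    ‖schwarzKernel x z - schwarzKernel y z‖ ≤ 16 / (1 - ‖z‖) ^ 2 * |x - y| := by
  have hd : 0 < 1 - ‖z‖ := by linarith
  have hx := circlePoint_sub_ne_zero hz x
  have hy := circlePoint_sub_ne_zero hz y
  have e : schwarzKernel x z - schwarzKernel y z
      = -(2 * z * (circlePoint x - circlePoint y))
        / ((circlePoint x - z) * (circlePoint y - z)) := by
    rw [schwarzKernel, schwarzKernel]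
    field_simp
    ring
  rw [e, norm_div, norm_neg, norm_mul, norm_mul, norm_mul, Complex.norm_two]
  have h1 : (1 - ‖z‖) ^ 2 ≤ ‖circlePoint x - z‖ * ‖circlePoint y - z‖ := by
    rw [sq]
    exact mul_le_mul (one_sub_norm_le x z) (one_sub_norm_le y z) hd.le (norm_nonneg _)
  have h2 : 2 * ‖z‖ * ‖circlePoint x - circlePoint y‖ ≤ 16 * |x - y| := by
    have h3 := norm_circlePoint_sub_circlePoint_le x y
    have h4 : 2 * Real.pi * |x - y| ≤ 8 * |x - y| := by
      gcongr; linarith [Real.pi_le_four]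
    calc 2 * ‖z‖ * ‖circlePoint x - circlePoint y‖ ≤ 2 * 1 * (8 * |x - y|) := by
          gcongr; exact h3.trans h4
      _ = 16 * |x - y| := by ring
  rw [div_mul_eq_mul_div]
  exact div_le_div₀ (by positivity) h2 (by positivity) h1

theorem norm_schwarzKernel_le {z : ℂ} (hz : ‖z‖ < 1) (x : ℝ) :
    ‖schwarzKernel x z‖ ≤ 2 / (1 - ‖z‖) := by
  rw [schwarzKernel, norm_div]
  refine div_le_div₀ (by norm_num) ?_ (by linarith) (one_sub_norm_le x z)
  refine (norm_add_le _ _).trans ?_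
  rw [norm_circlePoint]; linarith

theorem continuous_schwarzKernel {z : ℂ} (hz : ‖z‖ < 1) : Continuous (schwarzKernel · z) :=
  (continuous_circlePoint.add continuous_const).div
    (continuous_circlePoint.sub continuous_const) fun x => circlePoint_sub_ne_zero hz x

theorem integral_schwarzKernel {z : ℂ} (hz : ‖z‖ < 1) :
    ∫ x in Ico (0:ℝ) 1, schwarzKernel x z = 1 := by
  have hc : Continuous fun x : ℝ => circlePoint x / (circlePoint x - z) :=
    continuous_circlePoint.div (continuous_circlePoint.sub continuous_const)
      fun x => circlePoint_sub_ne_zero hz x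
  have h1 : ∫ x in (0:ℝ)..1, circlePoint x / (circlePoint x - z) = 1 := by
    have h := (diffContOnCl_const (c := (1:ℂ)) (s := ball (0:ℂ) |(1:ℝ)|)).circleAverage_smul_div
      (w := z) (by simpa using hz)
    rw [Real.circleAverage_def] at h
    have h2 := intervalIntegral.smul_integral_comp_mul_left (a := 0) (b := 1)
      (fun θ : ℝ => ((circleMap 0 1 θ - 0) / (circleMap 0 1 θ - z)) • (1:ℂ)) (2 * Real.pi)
    rw [mul_zero, mul_one] at h2
    rw [← h2, smul_smul, inv_mul_cancel₀ (by positivity), one_smul] at h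
    rw [← h]
    refine intervalIntegral.integral_congr fun x _ => ?_
    simp [circlePoint, circleMap]
  have h2 : ∀ x, schwarzKernel x z = 2 * (circlePoint x / (circlePoint x - z)) - 1 := fun x => by
    have := circlePoint_sub_ne_zero hz x
    rw [schwarzKernel]
    field_simp
    ring
  have hc2 : Continuous fun x : ℝ => 2 * (circlePoint x / (circlePoint x - z)) :=
    continuous_const.mul hc
  simp only [h2]
  rw [integral_Ico_eq_integral_Ioc, ← intervalIntegral.integral_of_le zero_le_one,
    intervalIntegral.integral_sub (hc2.intervalIntegrable _ _) intervalIntegrable_const,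
    intervalIntegral.integral_const_mul, h1]
  norm_num

/-- The Schwarz integral of a function on the circle, in the coordinate `x ↦ e^{2πix}`. -/
def schwarzIntegral (v : ℝ → ℝ) (z : ℂ) : ℂ := ∫ x, (v x : ℂ) * schwarzKernel x z

theorem integrable_mul_schwarzKernel {v : ℝ → ℝ} (hv : Integrable v) {z : ℂ} (hz : ‖z‖ < 1) :
    Integrable fun x => (v x : ℂ) * schwarzKernel x z :=
  hv.ofReal.mul_bdd (continuous_schwarzKernel hz).aestronglyMeasurable
    (ae_of_all _ (norm_schwarzKernel_le hz))

theorem differentiableOn_schwarzIntegral {v : ℝ → ℝ} (hv : Integrable v) :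
    DifferentiableOn ℂ (schwarzIntegral v) (ball 0 1) := by
  intro z hz
  have hz1 : ‖z‖ < 1 := by simpa using hz
  set δ := (1 - ‖z‖) / 2 with hδ
  have hδ0 : 0 < δ := by rw [hδ]; linarith
  have hw : ∀ w ∈ ball z δ, ‖w‖ < 1 - δ := fun w hw => by
    have h1 := norm_le_norm_add_norm_sub' w z
    rw [mem_ball, dist_eq_norm] at hw
    linarith
  have hcont : Continuous fun x => 2 * circlePoint x / (circlePoint x - z) ^ 2 :=
    (continuous_const.mul continuous_circlePoint).div
      ((continuous_circlePoint.sub continuous_const).pow 2)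
      fun x => pow_ne_zero 2 (circlePoint_sub_ne_zero hz1 x)
  have key := hasDerivAt_integral_of_dominated_loc_of_deriv_le (μ := volume) (𝕜 := ℂ)
    (F := fun w x => (v x : ℂ) * schwarzKernel x w)
    (F' := fun w x => (v x : ℂ) * (2 * circlePoint x / (circlePoint x - w) ^ 2))
    (x₀ := z) (s := ball z δ) (bound := fun x => ‖v x‖ * (2 / δ ^ 2))
    (ball_mem_nhds z hδ0) ?_ (integrable_mul_schwarzKernel hv hz1)
    (hv.ofReal.aestronglyMeasurable.mul hcont.aestronglyMeasurable) ?_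
    (hv.norm.mul_const _) ?_
  · exact key.2.differentiableAt.differentiableWithinAt
  · filter_upwards [ball_mem_nhds z hδ0] with w hw'
    exact (integrable_mul_schwarzKernel hv ((hw w hw').trans_le (by linarith))).1
  · refine ae_of_all _ fun x w hw' => ?_
    rw [norm_mul, norm_real, norm_div, norm_mul, norm_pow, norm_circlePoint, Complex.norm_two,
      mul_one]
    have : δ ≤ ‖circlePoint x - w‖ := by linarith [one_sub_norm_le x w, hw w hw']
    gcongr
  · refine ae_of_all _ fun x w hw' => ?_
    have hne := circlePoint_sub_ne_zero ((hw w hw').trans_le (by linarith)) x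
    have h1 : HasDerivAt (fun w => schwarzKernel x w)
        ((1 * (circlePoint x - w) - (circlePoint x + w) * (-1)) / (circlePoint x - w) ^ 2) w :=
      ((hasDerivAt_id w).const_add _).div ((hasDerivAt_id w).const_sub _) hne
    refine (h1.const_mul (v x : ℂ)).congr_deriv ?_
    congr 2
    ring

theorem re_schwarzIntegral {v : ℝ → ℝ} (hv : Integrable v) {z : ℂ} (hz : ‖z‖ < 1) :
    (schwarzIntegral v z).re = ∫ x, v x * (schwarzKernel x z).re := by
  have h := integral_re (integrable_mul_schwarzKernel hv hz)
  simp only [RCLike.re_to_complex, re_ofReal_mul] at h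
  exact h.symm

theorem measureReal_dyadicIco (m : ℕ) (k : ℤ) : volume.real (dyadicIco m k) = 1 / 2 ^ m := by
  rw [measureReal_def, volume_dyadicIco, ENNReal.toReal_ofReal (by positivity)]

theorem integrableOn_const_dyadicIco {E : Type*} [NormedAddCommGroup E] (m : ℕ) (k : ℤ) (a : E) :
    IntegrableOn (fun _ => a) (dyadicIco m k) :=
  integrableOn_const (by rw [volume_dyadicIco]; exact ENNReal.ofReal_ne_top)

theorem abs_sub_le_of_mem_dyadicIco {m : ℕ} {k : ℤ} {x : ℝ} (hx : x ∈ dyadicIco m k) :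
    |x - k / 2 ^ m| ≤ 1 / 2 ^ m := by
  obtain ⟨h1, h2⟩ := hx
  rw [add_div] at h2
  rw [abs_of_nonneg (by linarith)]
  linarith

theorem setIntegral_dyadicIco_mul_le {v g : ℝ → ℝ} {L B : ℝ} {m : ℕ} {k : ℤ}
    (hv0 : ∀ x, 0 ≤ v x) (hv : Integrable v) (hvg : Integrable fun x => v x * g x)
    (hgc : Continuous g) (hg0 : ∀ x, 0 ≤ g x) (hL0 : 0 ≤ L)
    (hL : ∀ x y, |g x - g y| ≤ L * |x - y|) (hB0 : 0 ≤ B)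
    (hB : ∫ x in dyadicIco m k, v x ≤ B / 2 ^ m) :
    ∫ x in dyadicIco m k, v x * g x ≤ B * ∫ x in dyadicIco m k, (g x + 2 * (L / 2 ^ m)) := by
  set l : ℝ := k / 2 ^ m
  have hgl : ∀ x ∈ dyadicIco m k, |g x - g l| ≤ L / 2 ^ m := fun x hx =>
    (hL x l).trans ((mul_le_mul_of_nonneg_left (abs_sub_le_of_mem_dyadicIco hx) hL0).trans
      (le_of_eq (by ring)))
  have hb : 0 ≤ g l + L / 2 ^ m := add_nonneg (hg0 l) (by positivity)
  have hgi : IntegrableOn g (dyadicIco m k) :=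
    (hgc.integrableOn_Icc (a := l) (b := (k + 1) / 2 ^ m)).mono_set Ico_subset_Icc_self
  calc ∫ x in dyadicIco m k, v x * g x
      ≤ ∫ x in dyadicIco m k, v x * (g l + L / 2 ^ m) := by
        refine setIntegral_mono_on hvg.integrableOn (hv.mul_const _).integrableOn
          (measurableSet_dyadicIco _ _) fun x hx => mul_le_mul_of_nonneg_left ?_ (hv0 x)
        linarith [le_abs_self (g x - g l), hgl x hx]
    _ ≤ B / 2 ^ m * (g l + L / 2 ^ m) := by
        rw [integral_mul_const]
        exact mul_le_mul_of_nonneg_right hB hb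
    _ = B * ∫ x in dyadicIco m k, (g l + L / 2 ^ m) := by
        rw [setIntegral_const, measureReal_dyadicIco, smul_eq_mul]
        ring
    _ ≤ B * ∫ x in dyadicIco m k, (g x + 2 * (L / 2 ^ m)) := by
        refine mul_le_mul_of_nonneg_left (setIntegral_mono_on (integrableOn_const_dyadicIco _ _ _)
          (hgi.add (integrableOn_const_dyadicIco _ _ _)) (measurableSet_dyadicIco _ _)
          fun x hx => ?_) hB0
        linarith [neg_abs_le (g x - g l), hgl x hx]

theorem IsBalancedDensity.schwarzIntegral_eq {c M : ℝ} {F : Set ℝ} {n : ℕ} {v : ℝ → ℝ}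
    (h : IsBalancedDensity c M F n v) (z : ℂ) :
    schwarzIntegral v z = ∫ x in Ico (0:ℝ) 1, (v x : ℂ) * schwarzKernel x z :=
  (setIntegral_eq_integral_of_forall_compl_eq_zero fun x hx => by simp [h.eq_zero x hx]).symm

theorem IsBalancedDensity.re_schwarzIntegral_le {c M : ℝ} {F : Set ℝ} {n : ℕ} {v : ℝ → ℝ}
    (h : IsBalancedDensity c M F n v) (hc : 0 ≤ c) (hM : 0 ≤ M) {z : ℂ} (hz : ‖z‖ < 1) {m : ℕ}
    (hm : n ≤ m) : (schwarzIntegral v z).re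
      ≤ (c * m + M) * (1 + 2 * (16 / (1 - ‖z‖) ^ 2 / 2 ^ m)) := by
  set L := 16 / (1 - ‖z‖) ^ 2 with hL
  have hL0 : 0 ≤ L := by positivity
  have hB0 : 0 ≤ c * m + M := by positivity
  have hgc : Continuous fun x => (schwarzKernel x z).re :=
    continuous_re.comp (continuous_schwarzKernel hz)
  have hgi : IntegrableOn (fun x => (schwarzKernel x z).re) (Ico 0 1) :=
    (hgc.integrableOn_Icc (a := 0) (b := 1)).mono_set Ico_subset_Icc_self
  have hci : IntegrableOn (fun _ : ℝ => 2 * (L / 2 ^ m)) (Ico 0 1) :=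
    integrableOn_const measure_Ico_lt_top.ne
  have hvg : Integrable fun x => v x * (schwarzKernel x z).re := by
    have := (integrable_mul_schwarzKernel h.integrable hz).re
    simpa only [RCLike.re_to_complex, re_ofReal_mul] using this
  have h1 : ∫ x in Ico (0:ℝ) 1, (schwarzKernel x z).re = 1 := by
    have h2 := integral_re (𝕜 := ℂ) (μ := volume.restrict (Ico (0:ℝ) 1))
      (f := fun x => schwarzKernel x z) (((continuous_schwarzKernel hz).integrableOn_Icc
        (a := 0) (b := 1)).mono_set Ico_subset_Icc_self)
    rw [integral_schwarzKernel hz] at h2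
    simpa using h2
  rw [re_schwarzIntegral h.integrable hz,
    ← setIntegral_eq_integral_of_forall_compl_eq_zero (s := Ico (0:ℝ) 1)
      fun x hx => by simp [h.eq_zero x hx],
    setIntegral_Ico_eq_sum_dyadicIco m hvg.integrableOn]
  calc ∑ k ∈ Finset.range (2 ^ m), ∫ x in dyadicIco m (k:ℤ), v x * (schwarzKernel x z).re
      ≤ ∑ k ∈ Finset.range (2 ^ m), (c * m + M) *
          ∫ x in dyadicIco m (k:ℤ), ((schwarzKernel x z).re + 2 * (L / 2 ^ m)) :=
        Finset.sum_le_sum fun k _ => setIntegral_dyadicIco_mul_le h.nonneg h.integrable hvg hgc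
          (re_schwarzKernel_nonneg hz) hL0 (fun x y => by
            rw [← sub_re]
            exact (abs_re_le_norm _).trans (norm_schwarzKernel_sub_le hz x y)) hB0
          (h.setIntegral_le m hm k)
    _ = (c * m + M) * (1 + 2 * (L / 2 ^ m)) := by
        rw [← Finset.mul_sum, ← setIntegral_Ico_eq_sum_dyadicIco m
            (f := fun x => (schwarzKernel x z).re + 2 * (L / 2 ^ m)) (hgi.add hci),
          integral_add hgi hci, h1, setIntegral_const]
        simp

theorem IsBalancedDensity.norm_schwarzIntegral_sub_le {c M : ℝ} {F : Set ℝ} {n : ℕ} {v : ℝ → ℝ}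
    (h : IsBalancedDensity c M F n v) (hM : 0 ≤ M) {z : ℂ} (hz : ‖z‖ < 1) :
    ‖schwarzIntegral v z - M‖ ≤ 32 * M / ((1 - ‖z‖) ^ 2 * 2 ^ n) := by
  set L := 16 / (1 - ‖z‖) ^ 2 with hL
  have hL0 : 0 ≤ L := by positivity
  have hki : IntegrableOn (fun x => schwarzKernel x z) (Ico 0 1) :=
    ((continuous_schwarzKernel hz).integrableOn_Icc (a := 0) (b := 1)).mono_set
      Ico_subset_Icc_self
  have hvk := integrable_mul_schwarzKernel h.integrable hz
  have e : schwarzIntegral v z - M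
      = ∫ x in Ico (0:ℝ) 1, ((v x - M : ℝ) : ℂ) * schwarzKernel x z := by
    rw [h.schwarzIntegral_eq, ← mul_one (M : ℂ), ← integral_schwarzKernel hz,
      ← integral_const_mul, ← integral_sub hvk.integrableOn (hki.const_mul _)]
    refine integral_congr_ae (ae_of_all _ fun x => ?_)
    push_cast
    ring
  have hi : IntegrableOn (fun x => ((v x - M : ℝ) : ℂ) * schwarzKernel x z) (Ico 0 1) := by
    refine (hvk.integrableOn.sub (hki.const_mul (M:ℂ))).congr (ae_of_all _ fun x => ?_)
    simp only [Pi.sub_apply]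
    push_cast
    ring
  rw [e, setIntegral_Ico_eq_sum_dyadicIco n hi]
  have hJ : ∀ k ∈ Finset.range (2 ^ n),
      ‖∫ x in dyadicIco n (k:ℤ), ((v x - M : ℝ) : ℂ) * schwarzKernel x z‖
        ≤ 2 * M * L / 2 ^ n * (1 / 2 ^ n) := by
    intro k hk
    have hk' := Finset.mem_range.1 hk
    set l : ℝ := ((k : ℤ) : ℝ) / 2 ^ n
    have hvi : IntegrableOn v (dyadicIco n (k:ℤ)) := h.integrable.integrableOn
    have hMi := integrableOn_const_dyadicIco n (k:ℤ) M
    have h0 : ∫ x in dyadicIco n (k:ℤ), ((v x - M : ℝ) : ℂ) * schwarzKernel l z = 0 := by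
      rw [integral_mul_const, integral_complex_ofReal, integral_sub hvi hMi, h.setIntegral_eq k hk',
        setIntegral_const, measureReal_dyadicIco, smul_eq_mul, one_div_mul_eq_div, sub_self,
        ofReal_zero, zero_mul]
    have hci : IntegrableOn (fun x => ((v x - M : ℝ) : ℂ) * schwarzKernel l z)
        (dyadicIco n (k:ℤ)) := (hvi.sub hMi).ofReal.mul_const _
    have hi' := hi.mono_set (dyadicIco_subset_Ico hk')
    rw [← sub_zero (∫ x in dyadicIco n (k:ℤ), ((v x - M : ℝ) : ℂ) * schwarzKernel x z), ← h0,
      ← integral_sub hi' hci]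
    refine (norm_integral_le_of_norm_le (((hvi.add hMi)).mul_const (L / 2 ^ n))
      ((ae_restrict_iff' (measurableSet_dyadicIco _ _)).2 (ae_of_all _ fun x hx => ?_))).trans ?_
    · rw [← mul_sub, norm_mul, norm_real, Real.norm_eq_abs]
      refine mul_le_mul ?_ ?_ (norm_nonneg _) (add_nonneg (h.nonneg x) hM)
      · rw [abs_le]
        constructor <;> simp only [Pi.add_apply] <;> linarith [h.nonneg x]
      · refine (norm_schwarzKernel_sub_le hz x l).trans ?_
        rw [← hL, div_eq_mul_one_div L]
        exact mul_le_mul_of_nonneg_left (abs_sub_le_of_mem_dyadicIco hx) hL0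
    · rw [integral_mul_const]
      simp only [Pi.add_apply]
      rw [integral_add hvi hMi, h.setIntegral_eq k hk',
        setIntegral_const, measureReal_dyadicIco, smul_eq_mul]
      exact le_of_eq (by ring)
  refine (norm_sum_le_of_le _ hJ).trans (le_of_eq ?_)
  rw [Finset.sum_const, Finset.card_range, nsmul_eq_mul, hL]
  push_cast
  field_simp
  ring

theorem IsBalancedDensity.re_schwarzIntegral_sub_le {p M : ℝ} {F : Set ℝ} {n : ℕ} {v : ℝ → ℝ}
    (hp : 1 ≤ p) (hM : 1 ≤ M) (h : IsBalancedDensity (1 / (16 * p * M)) M F n v) {z : ℂ}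
    (hz : ‖z‖ < 1) :
    p * (schwarzIntegral v z - M).re ≤ p + 2 + -(1 / 2) * Real.log (1 - ‖z‖) := by
  have hδ : 0 < 1 - ‖z‖ := by linarith
  have hlog : Real.log (1 - ‖z‖) ≤ 0 := Real.log_nonpos hδ.le (by linarith [norm_nonneg z])
  set δ := 1 - ‖z‖
  set A := 32 * M / δ ^ 2 with hA
  have hA0 : 0 < A := by positivity
  rcases le_or_gt A (2 ^ n) with hn | hn
  · have h1 : (schwarzIntegral v z - M).re ≤ 1 := by
      refine (re_le_norm _).trans ((h.norm_schwarzIntegral_sub_le (by linarith) hz).trans ?_)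
      rw [← div_div]
      exact (div_le_one (by positivity)).2 hn
    nlinarith
  · have hA1 : 1 ≤ A := (one_le_pow₀ one_le_two).trans hn.le
    obtain ⟨k, hk1, hk2⟩ := exists_nat_pow_near hA1 (one_lt_two (α := ℝ))
    set m := k + 1
    have hm2 : (2:ℝ) ^ m ≤ 2 * A := by rw [pow_succ']; linarith
    have hnm : n ≤ m := ((pow_lt_pow_iff_right₀ (one_lt_two (α := ℝ))).1 (hn.trans hk2)).le
    have h1 := h.re_schwarzIntegral_le (by positivity) (by linarith) hz hnm
    have h2 : 2 * (16 / δ ^ 2 / 2 ^ m) ≤ 1 / M := by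
      have e : 2 * (16 / δ ^ 2 / 2 ^ m) = A / 2 ^ m * (1 / M) := by
        rw [hA]; field_simp; norm_num
      rw [e]
      exact mul_le_of_le_one_left (by positivity) ((div_le_one (by positivity)).2 hk2.le)
    have h3 : (schwarzIntegral v z).re ≤ (1 / (16 * p * M) * m + M) * (1 + 1 / M) :=
      h1.trans (mul_le_mul_of_nonneg_left (by linarith) (by positivity))
    have h4 : (m : ℝ) * Real.log 2 ≤ Real.log 64 + Real.log M - 2 * Real.log δ := by
      have := Real.log_le_log (by positivity) hm2
      rw [Real.log_pow] at this
      refine this.trans (le_of_eq ?_)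
      rw [hA, show 2 * (32 * M / δ ^ 2) = 64 * M / δ ^ 2 by ring,
        Real.log_div (by positivity) (by positivity), Real.log_mul (by norm_num) (by positivity),
        Real.log_pow]
      norm_num
    have hl2 : 1 / 2 ≤ Real.log 2 := by linarith [Real.log_two_gt_d9]
    have hl64 : Real.log 64 ≤ 5 := by
      rw [show (64:ℝ) = 2 ^ 6 by norm_num, Real.log_pow]
      push_cast
      linarith [Real.log_two_lt_d9]
    have hlM := Real.log_le_sub_one_of_pos (show 0 < M by linarith)
    have h5 : (m : ℝ) ≤ 2 * (M * (5 - 2 * Real.log δ)) := by nlinarith [m.cast_nonneg (α := ℝ)]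
    have h6 : p * (1 / (16 * p * M) * m * (1 + 1 / M)) ≤ 1 / 4 * (5 - 2 * Real.log δ) := by
      have h7 : 1 / M ≤ 1 := (div_le_one (by linarith)).2 hM
      calc p * (1 / (16 * p * M) * m * (1 + 1 / M)) = m / (16 * M) * (1 + 1 / M) := by
            field_simp
        _ ≤ 2 * (M * (5 - 2 * Real.log δ)) / (16 * M) * (1 + 1) := by
            gcongr
            exact div_nonneg (by nlinarith) (by positivity)
        _ = 1 / 4 * (5 - 2 * Real.log δ) := by field_simp; ring
    have h8 : (1 / (16 * p * M) * m + M) * (1 + 1 / M) - M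
        = 1 / (16 * p * M) * m * (1 + 1 / M) + 1 := by field_simp; ring
    have h9 : p * (schwarzIntegral v z - M).re ≤ p * (1 / (16 * p * M) * m * (1 + 1 / M) + 1) := by
      rw [sub_re, ofReal_re]
      exact mul_le_mul_of_nonneg_left (by linarith) (by linarith)
    linarith

theorem IsBalancedDensity.exists_re_schwarzIntegral_le {c M : ℝ} {K : Set ℂ} {n : ℕ} {v : ℝ → ℝ}
    (h : IsBalancedDensity c M (circlePoint ⁻¹' K) n v) (hKc : IsCompact K)
    (hKT : K ⊆ sphere (0:ℂ) 1) :
    ∃ s : ℝ, s ∈ Ioo (0:ℝ) 1 ∧ ∀ ζ ∈ K, (schwarzIntegral v (s * ζ)).re ≤ 1 := by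
  have hsub : tsupport v ⊆ Icc 0 1 := closure_minimal
    (fun x hx => Ico_subset_Icc_self (not_not.1 fun h' => hx (h.eq_zero x h'))) isClosed_Icc
  have hcpt : IsCompact (circlePoint '' tsupport v) :=
    (isCompact_Icc.of_isClosed_subset (isClosed_tsupport v) hsub).image continuous_circlePoint
  have hdisj : Disjoint (circlePoint '' tsupport v) K := by
    rw [disjoint_image_left]
    exact h.disjoint
  obtain ⟨η, hη, hηK⟩ := Metric.exists_pos_forall_lt_edist hcpt hKc.isClosed hdisj
  have hη' : (0:ℝ) < η := hη
  have hI : 0 ≤ ∫ x, v x := integral_nonneg h.nonneg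
  set t : ℝ := min (1 / 2) (min (η / 2) (η ^ 2 / (8 * (1 + ∫ x, v x)))) with ht
  have ht0 : 0 < t := by positivity
  have ht1 : t ≤ 1 / 2 := min_le_left _ _
  have ht2 : t ≤ η / 2 := (min_le_right _ _).trans (min_le_left _ _)
  have ht3 : t ≤ η ^ 2 / (8 * (1 + ∫ x, v x)) := (min_le_right _ _).trans (min_le_right _ _)
  refine ⟨1 - t, ⟨by linarith, by linarith⟩, fun ζ hζ => ?_⟩
  have hζ1 : ‖ζ‖ = 1 := by simpa using hKT hζ
  have hn : ‖((1 - t : ℝ) : ℂ) * ζ‖ = 1 - t := by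
    rw [norm_mul, hζ1, mul_one, norm_real, Real.norm_of_nonneg (by linarith)]
  have hlt : ‖((1 - t : ℝ) : ℂ) * ζ‖ < 1 := by rw [hn]; linarith
  rw [re_schwarzIntegral h.integrable hlt]
  have hle : ∀ x, v x * (schwarzKernel x (((1 - t : ℝ) : ℂ) * ζ)).re
      ≤ v x * (8 * t / η ^ 2) := by
    intro x
    by_cases hx : v x = 0
    · simp [hx]
    refine mul_le_mul_of_nonneg_left ?_ (h.nonneg x)
    have h1 : (η : ℝ) < dist (circlePoint x) ζ := by
      have := hηK _ (mem_image_of_mem _ (subset_tsupport v hx)) ζ hζ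
      rw [edist_nndist] at this
      exact_mod_cast this
    have h2 : dist (circlePoint x) ζ
        ≤ dist (circlePoint x) (((1 - t : ℝ) : ℂ) * ζ) + dist (((1 - t : ℝ) : ℂ) * ζ) ζ :=
      dist_triangle _ _ _
    have h3 : dist (((1 - t : ℝ) : ℂ) * ζ) ζ = t := by
      rw [dist_eq_norm, show ((1 - t : ℝ) : ℂ) * ζ - ζ = -((t : ℂ) * ζ) by push_cast; ring,
        norm_neg, norm_mul, hζ1, mul_one, norm_real, Real.norm_of_nonneg ht0.le]
    have h4 : (η:ℝ) / 2 ≤ ‖circlePoint x - ((1 - t : ℝ) : ℂ) * ζ‖ := by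
      rw [← dist_eq_norm]; linarith
    rw [re_schwarzKernel, hn]
    calc (1 - (1 - t) ^ 2) / ‖circlePoint x - ((1 - t : ℝ) : ℂ) * ζ‖ ^ 2
        ≤ (2 * t) / ((η:ℝ) / 2) ^ 2 := by
          refine div_le_div₀ (by positivity) (by nlinarith) (by positivity) (by gcongr)
      _ = 8 * t / η ^ 2 := by field_simp; norm_num
  have h_int : Integrable fun x => v x * (schwarzKernel x (((1 - t : ℝ) : ℂ) * ζ)).re := by
    have := (integrable_mul_schwarzKernel h.integrable hlt).re
    simpa only [RCLike.re_to_complex, re_ofReal_mul] using this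
  refine (integral_mono h_int (h.integrable.mul_const _) hle).trans ?_
  rw [integral_mul_const]
  rw [le_div_iff₀ (by positivity)] at ht3
  rw [mul_div_assoc', div_le_one (by positivity)]
  nlinarith

theorem exists_vanishing_exp {p : ℝ} (hp : 1 ≤ p) {K : Set ℂ} (hKc : IsCompact K)
    (hKT : K ⊆ sphere (0:ℂ) 1) (hK : BergmanAdmissible K) (N : ℕ) :
    ∃ H : ℂ → ℂ, DifferentiableOn ℂ H (ball 0 1) ∧ ContinuousOn H (closedBall 0 1) ∧
      (∀ z ∈ ball (0:ℂ) 1, p * (H z).re ≤ p + 2 + -(1 / 2) * Real.log (1 - ‖z‖)) ∧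
      (∀ z ∈ ball (0:ℂ) 1, ‖H z‖ ≤ 32 / (1 - ‖z‖) ^ 2 * (1 / (N + 1))) ∧
      ∀ ζ ∈ K, (H ζ).re ≤ -N := by
  set M : ℝ := N + 1 with hM
  have hM1 : 1 ≤ M := by rw [hM]; linarith [N.cast_nonneg (α := ℝ)]
  obtain ⟨n, hn1, hn2⟩ := ((eventually_ge_atTop 1).and
    ((tendsto_pow_atTop_atTop_of_one_lt (one_lt_two (α := ℝ))).eventually_ge_atTop
      (M ^ 2))).exists
  obtain ⟨v, hv⟩ := exists_isBalancedDensity (c := 1 / (16 * p * M)) (M := M) (n := n)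
    (by positivity) (by positivity) hn1 hKc hK
  obtain ⟨s, ⟨hs0, hs1⟩, hs⟩ := hv.exists_re_schwarzIntegral_le hKc hKT
  have hsz : ∀ z : ℂ, ‖(s : ℂ) * z‖ = s * ‖z‖ := fun z => by
    rw [norm_mul, norm_real, Real.norm_of_nonneg hs0.le]
  have hmaps : MapsTo (fun z => (s : ℂ) * z) (closedBall 0 1) (ball 0 1) := fun z hz => by
    rw [mem_closedBall_zero_iff] at hz
    rw [mem_ball_zero_iff, hsz]
    nlinarith [norm_nonneg z]
  have hd : DifferentiableOn ℂ (fun z => schwarzIntegral v (s * z) - M) (closedBall 0 1) :=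
    ((differentiableOn_schwarzIntegral hv.integrable).comp
      (differentiableOn_id.const_mul (s : ℂ)) hmaps).sub_const _
  have hz1 : ∀ z ∈ ball (0:ℂ) 1, ‖(s:ℂ) * z‖ < 1 ∧ 0 < 1 - ‖z‖ ∧ 1 - ‖z‖ ≤ 1 - ‖(s:ℂ) * z‖ := by
    intro z hz
    rw [mem_ball_zero_iff] at hz
    rw [hsz]
    exact ⟨by nlinarith [norm_nonneg z], by linarith, by nlinarith [norm_nonneg z]⟩
  refine ⟨fun z => schwarzIntegral v (s * z) - M, hd.mono ball_subset_closedBall, hd.continuousOn,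
    fun z hz => ?_, fun z hz => ?_, fun ζ hζ => ?_⟩
  · obtain ⟨h1, h2, h3⟩ := hz1 z hz
    have := hv.re_schwarzIntegral_sub_le hp hM1 h1
    have := Real.log_le_log h2 h3
    linarith
  · obtain ⟨h1, h2, h3⟩ := hz1 z hz
    refine (hv.norm_schwarzIntegral_sub_le (by linarith) h1).trans ?_
    calc 32 * M / ((1 - ‖(s:ℂ) * z‖) ^ 2 * 2 ^ n) ≤ 32 * M / ((1 - ‖z‖) ^ 2 * M ^ 2) := by gcongr
      _ = 32 / (1 - ‖z‖) ^ 2 * (1 / M) := by field_simp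
  · rw [sub_re, ofReal_re, hM]
    linarith [hs ζ hζ]

theorem integrableOn_ball_one_sub_norm_rpow {a : ℝ} (ha : -1 < a) :
    IntegrableOn (fun z : ℂ => (1 - ‖z‖) ^ a) (ball 0 1) := by
  rw [integrableOn_fun_norm_addHaar volume (f := fun y : ℝ => (1 - y) ^ a), finrank_real_complex]
  have h := (intervalIntegral.intervalIntegrable_rpow' (a := 0) (b := 1) ha).comp_sub_left 1
  rw [sub_zero, sub_self] at h
  have h2 : IntegrableOn (fun y : ℝ => (1 - y) ^ a) (Ioo 0 1) :=
    ((intervalIntegrable_iff_integrableOn_Ioc_of_le zero_le_one).1 h.symm).mono_set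
      Ioo_subset_Ioc_self
  refine h2.mono' ?_ ((ae_restrict_iff' measurableSet_Ioo).2 (ae_of_all _ fun y hy => ?_))
  · exact (continuous_pow 1).aestronglyMeasurable.smul h2.aestronglyMeasurable
  · have h3 : 0 ≤ (1 - y) ^ a := Real.rpow_nonneg (by linarith [hy.2]) _
    rw [smul_eq_mul, pow_one, norm_mul, Real.norm_of_nonneg hy.1.le, Real.norm_of_nonneg h3]
    exact mul_le_of_le_one_left h3 hy.2.le

theorem norm_exp_sub_one_rpow_le {p : ℝ} (hp : 0 ≤ p) (w : ℂ) :
    ‖Complex.exp w - 1‖ ^ p ≤ 2 ^ p * (Real.exp (p * w.re) + 1) := by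
  have h1 : ‖Complex.exp w - 1‖ ≤ 2 * max (Real.exp w.re) 1 := by
    refine (norm_sub_le _ _).trans ?_
    rw [norm_exp, norm_one]
    linarith [le_max_left (Real.exp w.re) 1, le_max_right (Real.exp w.re) 1]
  have h2 : (max (Real.exp w.re) 1) ^ p ≤ Real.exp (p * w.re) + 1 := by
    rcases max_cases (Real.exp w.re) 1 with h | h
    · rw [h.1, ← Real.exp_mul, mul_comm]
      linarith
    · rw [h.1, Real.one_rpow]
      linarith [Real.exp_pos (p * w.re)]
  calc ‖Complex.exp w - 1‖ ^ p ≤ (2 * max (Real.exp w.re) 1) ^ p := by gcongr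
    _ = 2 ^ p * (max (Real.exp w.re) 1) ^ p := Real.mul_rpow (by norm_num) (by positivity)
    _ ≤ 2 ^ p * (Real.exp (p * w.re) + 1) := by gcongr

theorem tendsto_eLpNorm_exp_sub_one {p : ℝ} (hp : 1 ≤ p) {C : ℝ} {H : ℕ → ℂ → ℂ}
    (hH : ∀ N, ContinuousOn (H N) (ball 0 1))
    (hC : ∀ N, ∀ z ∈ ball (0:ℂ) 1, p * (H N z).re ≤ C + -(1 / 2) * Real.log (1 - ‖z‖))
    (hlim : ∀ z ∈ ball (0:ℂ) 1, Tendsto (fun N => H N z) atTop (𝓝 0)) :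
    Tendsto (fun N => eLpNorm (fun z => Complex.exp (H N z) - 1) (ENNReal.ofReal p) diskMeasure)
      atTop (𝓝 0) := by
  have hp0 : 0 < p := by linarith
  have hcont : ∀ N, ContinuousOn (fun z => Complex.exp (H N z) - 1) (ball 0 1) :=
    fun N => (hH N).cexp.sub continuousOn_const
  have hcontp : ∀ N, ContinuousOn (fun z => ‖Complex.exp (H N z) - 1‖ ^ p) (ball 0 1) :=
    fun N => (hcont N).norm.rpow_const fun _ _ => Or.inr hp0.le
  have hbound : Integrable (fun z : ℂ =>
      2 ^ p * (Real.exp C * (1 - ‖z‖) ^ (-(1 / 2) : ℝ) + 1)) diskMeasure :=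
    (((integrableOn_ball_one_sub_norm_rpow (by norm_num)).const_mul _).add
      (integrableOn_const measure_ball_lt_top.ne)).const_mul _
  have hle : ∀ N, ∀ᵐ z ∂diskMeasure, ‖‖Complex.exp (H N z) - 1‖ ^ p‖
      ≤ 2 ^ p * (Real.exp C * (1 - ‖z‖) ^ (-(1 / 2) : ℝ) + 1) := fun N => by
    refine (ae_restrict_iff' measurableSet_ball).2 (ae_of_all _ fun z hz => ?_)
    have hz1 : 0 < 1 - ‖z‖ := by rw [mem_ball_zero_iff] at hz; linarith
    rw [Real.norm_of_nonneg (by positivity)]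
    refine (norm_exp_sub_one_rpow_le hp0.le _).trans ?_
    rw [Real.rpow_def_of_pos hz1, ← Real.exp_add, mul_comm (Real.log _)]
    gcongr
    exact hC N z hz
  have hmeas : ∀ N, AEStronglyMeasurable (fun z => ‖Complex.exp (H N z) - 1‖ ^ p) diskMeasure :=
    fun N => (hcontp N).aestronglyMeasurable measurableSet_ball
  have hmem : ∀ N, MemLp (fun z => Complex.exp (H N z) - 1) (ENNReal.ofReal p) diskMeasure := by
    intro N
    have hm : AEStronglyMeasurable (fun z => Complex.exp (H N z) - 1) diskMeasure :=
      (hcont N).aestronglyMeasurable measurableSet_ball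
    rw [← integrable_norm_rpow_iff hm
      (by simpa using hp0) ENNReal.ofReal_ne_top, ENNReal.toReal_ofReal hp0.le]
    exact hbound.mono' (hmeas N) (hle N)
  have key := tendsto_integral_of_dominated_convergence _ hmeas hbound hle (f := fun _ => 0)
    ((ae_restrict_iff' measurableSet_ball).2 (ae_of_all _ fun z hz => by
      have h := ((((Complex.continuous_exp.tendsto 0).comp (hlim z hz)).sub_const 1).norm.rpow_const
        (Or.inr hp0.le) (p := p))
      simpa [Real.zero_rpow hp0.ne'] using h))
  rw [integral_zero] at key
  have key2 := ENNReal.tendsto_ofReal (key.rpow_const (Or.inr (inv_nonneg.2 hp0.le)) (p := p⁻¹))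
  rw [Real.zero_rpow (inv_ne_zero hp0.ne'), ENNReal.ofReal_zero] at key2
  refine key2.congr fun N => ?_
  rw [(hmem N).eLpNorm_eq_integral_rpow_norm (by simpa using hp0) ENNReal.ofReal_ne_top,
    ENNReal.toReal_ofReal hp0.le]

theorem BergmanAdmissible.hasVanishingUnits {p : ℝ} (hp : 1 ≤ p) {K : Set ℂ} (hKc : IsCompact K)
    (hKT : K ⊆ sphere (0:ℂ) 1) (hK : BergmanAdmissible K) : HasVanishingUnits p K := by
  intro ε hε
  choose H hd hc hre hnorm hvan using exists_vanishing_exp hp hKc hKT hK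
  have hlim : ∀ z ∈ ball (0:ℂ) 1, Tendsto (fun N => H N z) atTop (𝓝 0) := fun z hz => by
    refine squeeze_zero_norm (hnorm · z hz) ?_
    have := (tendsto_one_div_add_atTop_nhds_zero_nat (𝕜 := ℝ)).const_mul (32 / (1 - ‖z‖) ^ 2)
    rwa [mul_zero] at this
  have h1 := (tendsto_eLpNorm_exp_sub_one hp (fun N => (hd N).continuousOn) hre
    hlim).eventually_le_const (ENNReal.ofReal_pos.2 hε)
  have h2 : ∀ᶠ N in atTop, ‖Complex.exp (H N 0) - 1‖ ≤ ε := by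
    have h := (((Complex.continuous_exp.tendsto 0).comp
      (hlim 0 (mem_ball_self one_pos))).sub_const 1).norm
    rw [Complex.exp_zero, sub_self, norm_zero] at h
    exact h.eventually_le_const hε
  have h3 : ∀ᶠ N : ℕ in atTop, Real.exp (-(N : ℝ)) ≤ ε :=
    (Real.tendsto_exp_neg_atTop_nhds_zero.comp
      tendsto_natCast_atTop_atTop).eventually_le_const hε
  obtain ⟨N, h1, h2, h3⟩ := (h1.and (h2.and h3)).exists
  refine ⟨fun z => Complex.exp (H N z), ⟨(hd N).cexp, ?_⟩, h1, h2, fun ζ hζ => ?_⟩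
  · rw [closure_ball _ one_ne_zero]
    exact (hc N).cexp
  · rw [norm_exp]
    exact (Real.exp_le_exp.2 (hvan N ζ hζ)).trans h3

/-- Theorem (bergmain): for `1 ≤ p < ∞`, `ρ ⊆ [0,1)` with `1` as a limit point, and `K ⊆ 𝕋`
compact which either has positive measure but contains no compact subset of positive measure
satisfying Carleson's condition, or has zero measure, `𝒱_{A^p}^K(𝔻,ρ)` is a dense `G_δ`
subset of `A^p(𝔻)`. -/
theorem statement_5 (p : ℝ) (hp : 1 ≤ p)
    (ρ : Set ℝ) (hρ : ρ ⊆ Set.Ico (0:ℝ) 1) (hρ1 : AccPt (1:ℝ) (Filter.principal ρ))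
    (K : Set ℂ) (hKc : IsCompact K) (hKT : K ⊆ Metric.sphere (0:ℂ) 1)
    (hK : BergmanAdmissible K) :
    IsGδ (VAp p ρ K) ∧ Dense (VAp p ρ K) := by
  have : Fact (1 ≤ p) := ⟨hp⟩
  exact isGδ_dense_VAp_of_approx hρ hρ1 hKc hKT fun ψ f ε hε =>
    (hK.hasVanishingUnits hp hKc hKT).exists_approx hKc hKT ψ f ε hε
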